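/- arXiv:0809.2723 — 3 statements merged into one kernel-verified Lean document; each statement's English description precedes it below -/
import Mathlib

section
/- Let X be a real or complex Banach space and let Z be a closed subspace of X such that both Z and the quotient space X/Z are SCD spaces. Then X is an SCD space. -/
open Bornology Metric Topology

/-- The slice of a set `A` determined by the functional `f` and `ε`:
`S(A,f,ε) = {x ∈ A | Re f(x) > sup_{a ∈ A} Re f(a) - ε}`. -/
def Slice (𝕜 : Type*) [RCLike 𝕜] {X : Type*} [SeminormedAddCommGroup X] [NormedSpace 𝕜 X]
    (A : Set X) (f : X →L[𝕜] 𝕜) (ε : ℝ) : Set X :=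
  {x ∈ A | sSup ((fun a => RCLike.re (f a)) '' A) - ε < RCLike.re (f x)}

/-- `S` is a slice of `A`. -/
def IsSlice (𝕜 : Type*) [RCLike 𝕜] {X : Type*} [SeminormedAddCommGroup X] [NormedSpace 𝕜 X]
    (A S : Set X) : Prop :=
  ∃ (f : X →L[𝕜] 𝕜) (ε : ℝ), 0 < ε ∧ S = Slice 𝕜 A f ε

/-- A countable family `V` of subsets of `A` is determining for `A`:
`A` is contained in the closed convex hull of any `B ⊆ A` meeting every `V n`. -/
def Determining {X : Type*} [SeminormedAddCommGroup X] [NormedSpace ℝ X]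
    (A : Set X) (V : ℕ → Set X) : Prop :=
  ∀ B ⊆ A, (∀ n, (B ∩ V n).Nonempty) → A ⊆ closure (convexHull ℝ B)

/-- `A` is a slicely countably determined set: there is a determining sequence of
slices of `A`. -/
def IsSCD (𝕜 : Type*) [RCLike 𝕜] {X : Type*} [SeminormedAddCommGroup X] [NormedSpace ℝ X]
    [NormedSpace 𝕜 X] (A : Set X) : Prop :=
  ∃ S : ℕ → Set X, (∀ n, IsSlice 𝕜 A (S n)) ∧ Determining A S

/-- A (separable) Banach space is an SCD space if it is separable and every convex
bounded subset of it is an SCD set. -/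
def IsSCDSpace (𝕜 : Type*) [RCLike 𝕜] (X : Type*) [SeminormedAddCommGroup X]
    [NormedSpace ℝ X] [NormedSpace 𝕜 X] : Prop :=
  TopologicalSpace.SeparableSpace X ∧
    ∀ A : Set X, Convex ℝ A → IsBounded A → IsSCD 𝕜 A


section helpers

variable {𝕜 : Type*} [RCLike 𝕜] {X : Type*} [NormedAddCommGroup X]
    [NormedSpace ℝ X] [NormedSpace 𝕜 X] [IsScalarTower ℝ 𝕜 X]

/-- Real part of a functional as a real-linear functional. -/
noncomputable def reF (f : X →L[𝕜] 𝕜) : X →L[ℝ] ℝ :=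
  (RCLike.reCLM : 𝕜 →L[ℝ] ℝ).comp (f.restrictScalars ℝ)

lemma reF_apply (f : X →L[𝕜] 𝕜) (x : X) : reF f x = RCLike.re (f x) := rfl

lemma bddAbove_re {Y : Type*} [SeminormedAddCommGroup Y] [NormedSpace 𝕜 Y]
    {A : Set Y} (hA : IsBounded A) (f : Y →L[𝕜] 𝕜) :
    BddAbove ((fun a => RCLike.re (f a)) '' A) := by
  obtain ⟨M, hM⟩ := hA.exists_norm_le
  refine ⟨‖f‖ * M, ?_⟩
  rintro _ ⟨a, ha, rfl⟩
  calc RCLike.re (f a) ≤ ‖f a‖ := RCLike.re_le_norm _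
    _ ≤ ‖f‖ * ‖a‖ := f.le_opNorm a
    _ ≤ ‖f‖ * M := by gcongr; exact hM a ha

lemma isSlice_half {A : Set X} (hA : IsBounded A) (f : X →L[𝕜] 𝕜) (q : ℝ)
    (hne : {a ∈ A | q < RCLike.re (f a)}.Nonempty) :
    IsSlice 𝕜 A {a ∈ A | q < RCLike.re (f a)} := by
  obtain ⟨a, ha, hq⟩ := hne
  refine ⟨f, sSup ((fun a => RCLike.re (f a)) '' A) - q, ?_, ?_⟩
  · have := le_csSup (bddAbove_re hA f) ⟨a, ha, rfl⟩
    simp only at this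
    linarith
  · simp [Slice]

lemma isSlice_self {A : Set X} (hne : A.Nonempty) : IsSlice 𝕜 A A := by
  refine ⟨0, 1, one_pos, ?_⟩
  ext x
  have : (fun _ : X => (0 : ℝ)) '' A = {0} := hne.image_const 0
  simp [Slice, this]

lemma slice_nonempty {Y : Type*} [SeminormedAddCommGroup Y] [NormedSpace 𝕜 Y]
    {A : Set Y} (hne : A.Nonempty) (f : Y →L[𝕜] 𝕜) {ε : ℝ}
    (hε : 0 < ε) : (Slice 𝕜 A f ε).Nonempty := by
  obtain ⟨_, ⟨a, ha, rfl⟩, h⟩ := exists_lt_of_lt_csSup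
    (hne.image (fun a => RCLike.re (f a)))
    (show sSup ((fun a => RCLike.re (f a)) '' A) - ε < _ from by linarith)
  exact ⟨a, ha, h⟩

lemma two_dim {A B : Set X} (hA : IsBounded A) (hBA : B ⊆ A) (f g : X →L[ℝ] ℝ)
    (hB : ∀ α β q : ℚ, (∃ a ∈ A, (q : ℝ) < α * f a + β * g a) →
      ∃ b ∈ B, (q : ℝ) < α * f b + β * g b)
    (r s : ℝ) {p : X} (hp : p ∈ A) (hr : r < f p) (hs : s < g p) :
    ∃ b ∈ convexHull ℝ B, r < f b ∧ s < g b := by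
  by_contra! hcon
  set L : X →L[ℝ] ℝ × ℝ := f.prod g with hL
  have hdis : Disjoint (Set.Ioi r ×ˢ Set.Ioi s) (L '' convexHull ℝ B) := by
    rw [Set.disjoint_left]
    rintro _ ⟨h1, h2⟩ ⟨b, hb, rfl⟩
    exact absurd (hcon b hb h1) (not_le.2 h2)
  obtain ⟨u, t, hu1, hu2⟩ := geometric_hahn_banach_open
    ((convex_Ioi r).prod (convex_Ioi s)) (isOpen_Ioi.prod isOpen_Ioi)
    ((convex_convexHull ℝ B).linear_image (L : X →ₗ[ℝ] ℝ × ℝ)) hdis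
  have hu : ∀ x y : ℝ, u (x, y) = x * u (1, 0) + y * u (0, 1) := by
    intro x y
    have : ((x, y) : ℝ × ℝ) = x • (1, 0) + y • (0, 1) := by simp
    rw [this, map_add, map_smul, map_smul]; simp
  have h1 := hu1 (f p, g p) ⟨hr, hs⟩
  rw [hu] at h1
  obtain ⟨M, hM⟩ := hA.exists_norm_le
  obtain ⟨K, hK0, hKf, hKg⟩ : ∃ K : ℝ, 0 < K ∧ (∀ a ∈ A, |f a| ≤ K) ∧ ∀ a ∈ A, |g a| ≤ K := by
    have hM0 : 0 ≤ M := (norm_nonneg p).trans (hM p hp)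
    refine ⟨‖f‖ * M + ‖g‖ * M + 1, by positivity, ?_, ?_⟩
    · intro a ha
      have h2 : |f a| ≤ ‖f‖ * M := (f.le_opNorm a).trans (by gcongr; exact hM a ha)
      have : 0 ≤ ‖g‖ * M := by positivity
      linarith
    · intro a ha
      have h2 : |g a| ≤ ‖g‖ * M := (g.le_opNorm a).trans (by gcongr; exact hM a ha)
      have : 0 ≤ ‖f‖ * M := by positivity
      linarith
  set γ := t - (f p * u (1, 0) + g p * u (0, 1)) with hγ
  have hγ0 : 0 < γ := by linarith
  have hd : 0 < γ / (8 * K) := by positivity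
  obtain ⟨α, hα⟩ := Rat.denseRange_cast.exists_dist_lt (-u (1, 0)) hd
  obtain ⟨β, hβ⟩ := Rat.denseRange_cast.exists_dist_lt (-u (0, 1)) hd
  have key : ∀ a ∈ A, |(α * f a + β * g a) + (f a * u (1, 0) + g a * u (0, 1))| ≤ γ / 4 := by
    intro a ha
    have e : (α * f a + β * g a) + (f a * u (1, 0) + g a * u (0, 1))
        = (α + u (1, 0)) * f a + (β + u (0, 1)) * g a := by ring
    rw [e]
    rw [dist_comm, Real.dist_eq, sub_neg_eq_add] at hα hβ
    calc _ ≤ |((α : ℝ) + u (1, 0)) * f a| + |((β : ℝ) + u (0, 1)) * g a| := abs_add_le _ _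
      _ ≤ γ / (8 * K) * K + γ / (8 * K) * K := by
        rw [abs_mul, abs_mul]
        gcongr
        · exact hKf a ha
        · exact hKg a ha
      _ = γ / 4 := by field_simp; norm_num
  obtain ⟨q, hq1, hq2⟩ := exists_rat_btwn (show -t + γ / 4 < -t + γ / 2 by linarith)
  obtain ⟨b, hb, hqb⟩ := hB α β q ⟨p, hp, by
    have := (abs_le.1 (key p hp)).1
    linarith⟩
  have h2 := hu2 (L b) ⟨b, subset_convexHull ℝ B hb, rfl⟩
  have h3 : u (L b) = f b * u (1, 0) + g b * u (0, 1) := hu _ _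
  have := (abs_le.1 (key b (hBA hb))).2
  linarith

lemma isSCD_of {A : Set X} (hA : IsBounded A) (hne : A.Nonempty) (hcv : Convex ℝ A)
    {ι : Type*} [Countable ι] (G : ι → (X →L[𝕜] 𝕜))
    (h : ∀ C ⊆ A, Convex ℝ C →
      (∀ i j (r s : ℝ), (∃ a ∈ A, r < RCLike.re (G i a) ∧ s < RCLike.re (G j a)) →
        ∃ a ∈ C, r < RCLike.re (G i a) ∧ s < RCLike.re (G j a)) → A ⊆ closure C) :
    IsSCD 𝕜 A := by
  classical
  let H : ι × ι × ℚ × ℚ → (X →L[𝕜] 𝕜) := fun x =>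
    ((x.2.2.1 : ℝ) : 𝕜) • G x.1 + ((x.2.2.2 : ℝ) : 𝕜) • G x.2.1
  have hH : ∀ x a, RCLike.re (H x a) =
      x.2.2.1 * RCLike.re (G x.1 a) + x.2.2.2 * RCLike.re (G x.2.1 a) := by
    intro x a
    simp only [H, ContinuousLinearMap.add_apply, ContinuousLinearMap.smul_apply, smul_eq_mul,
      map_add, RCLike.re_ofReal_mul]
  let U : Option ((ι × ι × ℚ × ℚ) × ℚ) → Set X := fun o => match o with
    | none => A
    | some x => if {a ∈ A | (x.2 : ℝ) < RCLike.re (H x.1 a)}.Nonempty then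
        {a ∈ A | (x.2 : ℝ) < RCLike.re (H x.1 a)} else A
  obtain ⟨e, he⟩ := exists_surjective_nat (Option ((ι × ι × ℚ × ℚ) × ℚ))
  refine ⟨fun n => U (e n), fun n => ?_, fun B hBA hB => ?_⟩
  · change IsSlice 𝕜 A (U (e n))
    generalize e n = o
    rcases o with _ | x
    · exact isSlice_self hne
    · simp only [U]
      split_ifs with hx
      · exact isSlice_half hA _ _ hx
      · exact isSlice_self hne
  · refine h _ (convexHull_min hBA hcv) (convex_convexHull ℝ B) ?_
    rintro i j r s ⟨p, hp, hr, hs⟩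
    refine two_dim hA hBA (reF (G i)) (reF (G j)) ?_ r s hp hr hs
    rintro α β q ⟨a, ha, hq⟩
    obtain ⟨n, hn⟩ := he (some ((i, j, α, β), q))
    obtain ⟨b, hb, hbU⟩ := hB n
    have hx : {a ∈ A | (q : ℝ) < RCLike.re (H (i, j, α, β) a)}.Nonempty :=
      ⟨a, ha, by rw [hH]; exact hq⟩
    simp only [hn, U, if_pos hx] at hbU
    refine ⟨b, hb, ?_⟩
    have := hbU.2
    rw [hH] at this
    exact this

lemma quot_lift (Z : Submodule 𝕜 X) (x : X) {η : ℝ}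
    (h : ‖(Submodule.Quotient.mk x : X ⧸ Z)‖ < η) : ∃ z : Z, ‖x - z‖ < η := by
  obtain ⟨m, hm, hmr⟩ := Submodule.Quotient.norm_mk_lt (Submodule.Quotient.mk x : X ⧸ Z)
    (sub_pos.2 h)
  refine ⟨⟨x - m, (Submodule.Quotient.eq Z).1 hm.symm⟩, ?_⟩
  simp only [sub_sub_cancel]
  linarith

lemma sep_of (Z : Submodule 𝕜 X) (h1 : TopologicalSpace.SeparableSpace Z)
    (h2 : TopologicalSpace.SeparableSpace (X ⧸ Z)) : TopologicalSpace.SeparableSpace X := by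
  obtain ⟨s, hs⟩ := TopologicalSpace.exists_dense_seq Z
  obtain ⟨t, ht⟩ := TopologicalSpace.exists_dense_seq (X ⧸ Z)
  choose l hl using fun n => Submodule.Quotient.mk_surjective Z (t n)
  refine ⟨⟨Set.range (fun p : ℕ × ℕ => (s p.1 : X) + l p.2), Set.countable_range _, ?_⟩⟩
  rw [Metric.dense_iff]
  intro x r hr
  obtain ⟨n, hn⟩ := ht.exists_dist_lt (Submodule.Quotient.mk x : X ⧸ Z) (half_pos hr)
  rw [← hl n, dist_eq_norm, ← Submodule.Quotient.mk_sub] at hn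
  obtain ⟨z, hz⟩ := quot_lift Z _ hn
  obtain ⟨m, hm⟩ := hs.exists_dist_lt z (half_pos hr)
  refine ⟨_, ?_, ⟨(m, n), rfl⟩⟩
  rw [mem_ball, dist_comm, dist_eq_norm]
  have hm' : ‖(z : X) - s m‖ < r / 2 := by
    rw [dist_eq_norm] at hm; exact hm
  have e : x - ((s m : X) + l n) = (x - l n - z) + (z - s m) := by abel
  calc _ ≤ ‖x - l n - z‖ + ‖(z : X) - s m‖ := by simp only [e]; exact norm_add_le _ _
    _ < r := by linarith

/-- The thickened fibre. -/
def fib (Z : Submodule 𝕜 X) (A : Set X) (x : X) (δ : ℝ) : Set Z :=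
  {z | ∃ a ∈ A, ‖(z : X) + x - a‖ < δ}

lemma fib_convex (Z : Submodule 𝕜 X) {A : Set X} (hA : Convex ℝ A) (x : X) (δ : ℝ) :
    Convex ℝ (fib Z A x δ) := by
  rintro z ⟨a, ha, haz⟩ w ⟨b, hb, hbw⟩ s t hs ht hst
  refine ⟨s • a + t • b, hA ha hb hs ht hst, ?_⟩
  have e : ((s • z + t • w : Z) : X) + x - (s • a + t • b)
      = s • ((z : X) + x - a) + t • ((w : X) + x - b) := by
    have hx : x = s • x + t • x := by rw [← add_smul, hst, one_smul]
    have h1 : ((s • z + t • w : Z) : X) = s • (z : X) + t • (w : X) := by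
      rw [Submodule.coe_add, Submodule.coe_smul_of_tower, Submodule.coe_smul_of_tower]
    rw [h1]
    nth_rewrite 1 [hx]
    module
  rw [e]
  have := (convex_ball (0 : X) δ) (mem_ball_zero_iff.2 haz) (mem_ball_zero_iff.2 hbw) hs ht hst
  exact mem_ball_zero_iff.1 this

lemma fib_bounded (Z : Submodule 𝕜 X) {A : Set X} (hA : IsBounded A) (x : X) (δ : ℝ) :
    IsBounded (fib Z A x δ) := by
  obtain ⟨M, hM⟩ := hA.exists_norm_le
  rw [isBounded_iff_forall_norm_le]
  refine ⟨δ + M + ‖x‖, ?_⟩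
  rintro z ⟨a, ha, h⟩
  have e : (z : X) = ((z : X) + x - a) + a - x := by abel
  have h1 : ‖(z : X)‖ ≤ ‖(z : X) + x - a‖ + ‖a‖ + ‖x‖ := by
    nth_rewrite 1 [e]
    exact (norm_sub_le _ _).trans (by gcongr; exact norm_add_le _ _)
  have h2 := hM a ha
  rw [Submodule.norm_coe] at *
  linarith

lemma convex_mk_image (Z : Submodule 𝕜 X) {C : Set X} (hC : Convex ℝ C) :
    Convex ℝ ((Submodule.Quotient.mk : X → X ⧸ Z) '' C) := by
  rintro _ ⟨a, ha, rfl⟩ _ ⟨b, hb, rfl⟩ s t hs ht hst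
  exact ⟨s • a + t • b, hC ha hb hs ht hst, rfl⟩

lemma bounded_mk_image (Z : Submodule 𝕜 X) {C : Set X} (hC : IsBounded C) :
    IsBounded ((Submodule.Quotient.mk : X → X ⧸ Z) '' C) := by
  obtain ⟨M, hM⟩ := hC.exists_norm_le
  rw [isBounded_iff_forall_norm_le]
  refine ⟨M, ?_⟩
  rintro _ ⟨a, ha, rfl⟩
  exact (Submodule.Quotient.norm_mk_le Z a).trans (hM a ha)

/-- The quotient map as a continuous linear map. -/
noncomputable def qmk (Z : Submodule 𝕜 X) : X →L[𝕜] X ⧸ Z :=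
  LinearMap.mkContinuous Z.mkQ 1 (fun x => by
    rw [one_mul]; exact Submodule.Quotient.norm_mk_le Z x)

lemma qmk_apply (Z : Submodule 𝕜 X) (x : X) : qmk Z x = Submodule.Quotient.mk x := rfl

lemma convex_half {A : Set X} (hA : Convex ℝ A) (f : X →L[𝕜] 𝕜) (r : ℝ) :
    Convex ℝ {a ∈ A | r < RCLike.re (f a)} :=
  hA.inter ((convex_Ioi r).linear_preimage (reF f : X →ₗ[ℝ] ℝ))

/-- one-step approximation -/
lemma approx (Z : Submodule 𝕜 X) {A C : Set X} (hCA : C ⊆ A) (hC : Convex ℝ C)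
    (f : X →L[𝕜] 𝕜) (r : ℝ) (g : ℕ → (X ⧸ Z →L[𝕜] 𝕜)) (ε : ℕ → ℝ) (hε : ∀ n, 0 < ε n)
    (hdet : Determining (Submodule.Quotient.mk '' {a ∈ A | r < RCLike.re (f a)})
      (fun n => Slice 𝕜 (Submodule.Quotient.mk '' {a ∈ A | r < RCLike.re (f a)}) (g n) (ε n)))
    (hmeet : ∀ n (s : ℝ),
      (∃ a ∈ A, r < RCLike.re (f a) ∧ s < RCLike.re ((g n).comp (qmk Z) a)) →
        ∃ a ∈ C, r < RCLike.re (f a) ∧ s < RCLike.re ((g n).comp (qmk Z) a))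
    {a : X} (ha : a ∈ A) (har : r < RCLike.re (f a)) {η : ℝ} (hη : 0 < η) :
    ∃ b ∈ C, r < RCLike.re (f b) ∧ ‖(Submodule.Quotient.mk (b - a) : X ⧸ Z)‖ < η := by
  have hcv : Convex ℝ ((Submodule.Quotient.mk : X → X ⧸ Z) '' {b ∈ C | r < RCLike.re (f b)}) :=
    convex_mk_image Z (convex_half hC f r)
  have h := hdet ((Submodule.Quotient.mk : X → X ⧸ Z) '' {b ∈ C | r < RCLike.re (f b)})
    (Set.image_mono (fun b hb => ⟨hCA hb.1, hb.2⟩)) ?_ ⟨a, ⟨ha, har⟩, rfl⟩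
  · rw [hcv.convexHull_eq, Metric.mem_closure_iff] at h
    obtain ⟨_, ⟨b, hb, rfl⟩, hd⟩ := h η hη
    rw [dist_comm, dist_eq_norm] at hd
    exact ⟨b, hb.1, hb.2, hd⟩
  · intro n
    obtain ⟨_, ⟨p, hp, rfl⟩, hps⟩ := slice_nonempty
      (A := (Submodule.Quotient.mk : X → X ⧸ Z) '' {a ∈ A | r < RCLike.re (f a)})
      ⟨_, a, ⟨ha, har⟩, rfl⟩ (g n) (hε n)
    obtain ⟨b, hbC, hbr, hbs⟩ := hmeet n _ ⟨p, hp.1, hp.2, hps⟩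
    exact ⟨_, ⟨b, ⟨hbC, hbr⟩, rfl⟩, ⟨b, ⟨hCA hbC, hbr⟩, rfl⟩, hbs⟩

/-- fibre step -/
lemma fibre_step (Z : Submodule 𝕜 X) {A C : Set X} (hA : Convex ℝ A) (hCA : C ⊆ A)
    (hC : Convex ℝ C) (x : X) (hx : x ∈ A) {δ : ℝ} (hδ : 0 < δ)
    (f : ℕ → (X →L[𝕜] 𝕜)) (ε : ℕ → ℝ) (hε : ∀ n, 0 < ε n)
    (hdet : Determining (fib Z A x δ)
      (fun n => Slice 𝕜 (fib Z A x δ) ((f n).comp Z.subtypeL) (ε n)))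
    (happ : ∀ n, ∀ a ∈ A, ∀ r : ℚ, (r : ℝ) < RCLike.re (f n a) → ∀ η > 0,
      ∃ b ∈ C, (r : ℝ) < RCLike.re (f n b) ∧ ‖(Submodule.Quotient.mk (b - a) : X ⧸ Z)‖ < η) :
    ∃ b ∈ C, ‖x - b‖ < 2 * δ := by
  have h0 : (0 : Z) ∈ fib Z A x δ := ⟨x, hx, by simpa using hδ⟩
  have h := hdet (fib Z C x δ) (fun z ⟨b, hb, hz⟩ => ⟨b, hCA hb, hz⟩) ?_ h0
  · rw [(fib_convex Z hC x δ).convexHull_eq, Metric.mem_closure_iff] at h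
    obtain ⟨z, ⟨b, hb, hz⟩, hd⟩ := h δ hδ
    rw [dist_zero_left] at hd
    have hd' : ‖(z : X)‖ < δ := hd
    refine ⟨b, hb, ?_⟩
    have e : x - b = ((z : X) + x - b) - z := by abel
    rw [e]
    exact (norm_sub_le _ _).trans_lt (by linarith)
  · intro n
    obtain ⟨z, ⟨a, ha, hza⟩, hzs⟩ := slice_nonempty ⟨0, h0⟩ ((f n).comp Z.subtypeL) (hε n)
    set c := sSup ((fun a => RCLike.re (((f n).comp Z.subtypeL) a)) '' fib Z A x δ) - ε n with hc
    have hzs' : c < RCLike.re (f n z) := hzs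
    set κ := (RCLike.re (f n z) - c) / 2 with hκ
    have hκ0 : 0 < κ := by linarith
    obtain ⟨r, hr1, hr2⟩ := exists_rat_btwn (show RCLike.re (f n a) - κ < RCLike.re (f n a) by
      linarith)
    obtain ⟨η, hη0, hη1, hη2⟩ : ∃ η : ℝ, 0 < η ∧ ‖(z : X) + x - a‖ + η < δ ∧ ‖f n‖ * η < κ := by
      refine ⟨min ((δ - ‖(z : X) + x - a‖) / 2) (κ / (‖f n‖ + 1)), ?_, ?_, ?_⟩
      · refine lt_min (by linarith) (by positivity)
      · have := min_le_left ((δ - ‖(z : X) + x - a‖) / 2) (κ / (‖f n‖ + 1))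
        linarith
      · calc _ ≤ ‖f n‖ * (κ / (‖f n‖ + 1)) := by gcongr; exact min_le_right _ _
          _ < κ := by
            rw [← mul_div_assoc, div_lt_iff₀ (by positivity)]
            nlinarith
    obtain ⟨b, hbC, hbr, hbη⟩ := happ n a ha r hr2 η hη0
    obtain ⟨w, hw⟩ := quot_lift Z _ hbη
    have e1 : ((z + w : Z) : X) + x - b = ((z : X) + x - a) - (b - a - w) := by
      rw [Submodule.coe_add]; abel
    have hmem : ‖((z + w : Z) : X) + x - b‖ < δ := by
      rw [e1]; exact (norm_sub_le _ _).trans_lt (by linarith)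
    refine ⟨z + w, ⟨b, hbC, hmem⟩, ⟨b, hCA hbC, hmem⟩, ?_⟩
    change c < RCLike.re (f n ((z + w : Z) : X))
    have h3 : RCLike.re (f n (b - a - w)) ≤ ‖f n‖ * η :=
      (RCLike.re_le_norm _).trans (((f n).le_opNorm _).trans (by gcongr))
    rw [map_sub, map_sub, map_sub, map_sub] at h3
    rw [Submodule.coe_add, map_add, map_add]
    linarith

end helpers

/-- If `Z` is a closed subspace of a Banach space `X` such that both `Z`
and the quotient `X/Z` are SCD spaces, then `X` is an SCD space. -/
theorem statement10 {𝕜 : Type*} [RCLike 𝕜] {X : Type*} [NormedAddCommGroup X]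
    [NormedSpace ℝ X] [NormedSpace 𝕜 X] [IsScalarTower ℝ 𝕜 X] [CompleteSpace X]
    (Z : Submodule 𝕜 X) (hZ : IsClosed (Z : Set X))
    (hZscd : IsSCDSpace 𝕜 Z) (hQscd : IsSCDSpace 𝕜 (X ⧸ Z)) :
    IsSCDSpace 𝕜 X := by
  obtain ⟨hZs, hZ2⟩ := hZscd
  obtain ⟨hQs, hQ2⟩ := hQscd
  have hsep : TopologicalSpace.SeparableSpace X := sep_of Z hZs hQs
  refine ⟨hsep, fun A hA hAb => ?_⟩
  rcases A.eq_empty_or_nonempty with rfl | hne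
  · exact ⟨fun _ => Slice 𝕜 ∅ 0 1, fun _ => ⟨0, 1, one_pos, rfl⟩, fun B _ _ => Set.empty_subset _⟩
  have : SecondCountableTopology X := UniformSpace.secondCountable_of_separable X
  have : Nonempty A := hne.to_subtype
  obtain ⟨x, hx⟩ := TopologicalSpace.exists_dense_seq A
  have hδ : ∀ j : ℕ, (0 : ℝ) < 1 / ((j : ℝ) + 1) := fun j => by positivity
  -- functionals determining the thickened fibres
  have hfib : ∀ n j : ℕ, ∃ (f : ℕ → (X →L[𝕜] 𝕜)) (ε : ℕ → ℝ), (∀ k, 0 < ε k) ∧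
      Determining (fib Z A (x n) (1 / ((j : ℝ) + 1)))
        (fun k => Slice 𝕜 (fib Z A (x n) (1 / ((j : ℝ) + 1))) ((f k).comp Z.subtypeL) (ε k)) := by
    intro n j
    obtain ⟨S, hS, hdet⟩ := hZ2 (fib Z A (x n) (1 / ((j : ℝ) + 1))) (fib_convex Z hA _ _)
      (fib_bounded Z hAb _ _)
    choose g ε hε hSg using hS
    choose f hf _ using fun k => exists_extension_norm_eq Z (g k)
    have hfg : ∀ k, (f k).comp Z.subtypeL = g k := fun k => by
      ext z; exact hf k z
    refine ⟨f, ε, hε, ?_⟩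
    have : S = fun k => Slice 𝕜 (fib Z A (x n) (1 / ((j : ℝ) + 1)))
        ((f k).comp Z.subtypeL) (ε k) := by
      funext k; rw [hfg, hSg]
    rw [← this]; exact hdet
  choose f ε hε hfdet using hfib
  have hquo : ∀ (n j k : ℕ) (r : ℚ), ∃ (g : ℕ → (X ⧸ Z →L[𝕜] 𝕜)) (e : ℕ → ℝ), (∀ m, 0 < e m) ∧
      Determining ((Submodule.Quotient.mk : X → X ⧸ Z) '' {a ∈ A | (r : ℝ) < RCLike.re (f n j k a)})
        (fun m => Slice 𝕜 (Submodule.Quotient.mk '' {a ∈ A | (r : ℝ) < RCLike.re (f n j k a)})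
          (g m) (e m)) := by
    intro n j k r
    obtain ⟨S, hS, hdet⟩ := hQ2
      ((Submodule.Quotient.mk : X → X ⧸ Z) '' {a ∈ A | (r : ℝ) < RCLike.re (f n j k a)})
      (convex_mk_image Z (convex_half hA _ _))
      (bounded_mk_image Z (hAb.subset (fun a ha => ha.1)))
    choose g e he hSg using hS
    refine ⟨g, e, he, ?_⟩
    rw [← funext hSg]; exact hdet
  choose g e he hgdet using hquo
  let G : (ℕ × ℕ × ℕ) ⊕ (ℕ × ℕ × ℕ × ℚ × ℕ) → (X →L[𝕜] 𝕜) := Sum.elim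
    (fun i => f i.1 i.2.1 i.2.2)
    (fun i => (g i.1 i.2.1 i.2.2.1 i.2.2.2.1 i.2.2.2.2).comp (qmk Z))
  refine isSCD_of hAb hne hA G fun C hCA hC hmeet => ?_
  have hxC : ∀ n, (x n : X) ∈ closure C := by
    intro n
    rw [Metric.mem_closure_iff]
    intro ρ hρ
    obtain ⟨j, hj⟩ := exists_nat_one_div_lt (half_pos hρ)
    obtain ⟨b, hb, hbx⟩ := fibre_step Z hA hCA hC (x n) (x n).2 (hδ j) (f n j) (ε n j) (hε n j)
      (hfdet n j) (fun k a ha r har η hη =>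
        approx Z hCA hC (f n j k) r (g n j k r) (e n j k r) (he n j k r) (hgdet n j k r)
          (fun m s => hmeet (Sum.inl (n, j, k)) (Sum.inr (n, j, k, r, m)) r s) ha har hη)
    refine ⟨b, hb, ?_⟩
    rw [dist_eq_norm]
    linarith
  intro a ha
  rw [← closure_closure, Metric.mem_closure_iff]
  intro ρ hρ
  obtain ⟨n, hn⟩ := hx.exists_dist_lt ⟨a, ha⟩ hρ
  exact ⟨x n, hxC n, hn⟩
end

section
/- Let X be a separable real or complex Banach space which is not an SCD space. Then X contains a closed subspace isomorphic to ℓ1, and for every closed subspace Y of X isomorphic to ℓ1, the quotient X/Y also contains a closed subspace isomorphic to ℓ1. -/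
open Bornology Metric Topology

/-- The Banach space `E` contains an isomorphic copy of `ℓ₁`: there is a bounded linear
map from `ℓ₁` into `E` which is bounded below (an isomorphic embedding onto a closed
subspace). -/
def ContainsCopyOfL1 (𝕜 : Type*) [RCLike 𝕜] (E : Type*) [SeminormedAddCommGroup E]
    [NormedSpace 𝕜 E] : Prop :=
  ∃ T : lp (fun _ : ℕ => 𝕜) 1 →L[𝕜] E, ∃ c : ℝ, 0 < c ∧ ∀ v, c * ‖v‖ ≤ ‖T v‖

namespace SCDProof

open Classical in
/-- Combinatorial core: an independent sequence from a failure of countable determination. -/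
theorem comb {α γ : Type*} [Countable α] (H L : α → γ → Prop) (p : α) (hp : ∀ g, H p g)
    (hD : ∀ D : Set γ, D.Countable → ∃ g, ∀ D1 D2 : Finset γ, (D1 : Set γ) ⊆ D → (D2 : Set γ) ⊆ D →
      (∃ a, (∀ f ∈ D1, H a f) ∧ (∀ f ∈ D2, L a f)) →
      ∃ a, (∀ f ∈ D1, H a f) ∧ (∀ f ∈ D2, L a f) ∧ L a g) :
    ∃ a : ℕ → α, ∀ (n : ℕ) (P : Set ℕ), ∃ g, ∀ i < n, (i ∈ P → L (a i) g) ∧ (i ∉ P → H (a i) g) := by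
  let Good : Set γ → γ → Prop := fun D g =>
    ∀ D1 D2 : Finset γ, (D1 : Set γ) ⊆ D → (D2 : Set γ) ⊆ D →
      (∃ a, (∀ f ∈ D1, H a f) ∧ (∀ f ∈ D2, L a f)) →
      ∃ a, (∀ f ∈ D1, H a f) ∧ (∀ f ∈ D2, L a f) ∧ L a g
  have hmono : ∀ {D D' : Set γ} {g}, D ⊆ D' → Good D' g → Good D g := by
    intro D D' g h hg D1 D2 h1 h2
    exact hg D1 D2 (h1.trans h) (h2.trans h)
  let U : Finset α × Finset α → Set γ := fun P => {g | (∀ a ∈ P.1, H a g) ∧ (∀ a ∈ P.2, L a g)}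
  let Large : Finset α × Finset α → Prop := fun P =>
    ∀ D : Set γ, D.Countable → ∃ g ∈ U P, Good D g
  have hDx : ∀ P, ∃ D : Set γ, D.Countable ∧ (¬ Large P → ∀ g ∈ U P, ¬ Good D g) := by
    intro P
    by_cases h : Large P
    · exact ⟨∅, Set.countable_empty, fun h' => absurd h h'⟩
    · have h' := h
      simp only [Large, not_forall, not_exists, not_and] at h'
      obtain ⟨D, hD, h''⟩ := h'
      exact ⟨D, hD, fun _ => h''⟩
  choose DD hDDc hDD using hDx
  let T : Set γ := {g | ∀ P, g ∈ U P → Large P}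
  have hT : ∀ P, Large P → ∀ D : Set γ, D.Countable → ∃ g ∈ U P, g ∈ T ∧ Good D g := by
    intro P hP D hDc
    obtain ⟨g, hgU, hg⟩ := hP (D ∪ ⋃ Q, DD Q) (hDc.union (Set.countable_iUnion hDDc))
    refine ⟨g, hgU, ?_, hmono Set.subset_union_left hg⟩
    intro Q hQ
    by_contra hL
    exact hDD Q hL g hQ (hmono ((Set.subset_iUnion DD Q).trans Set.subset_union_right) hg)
  -- one step
  have hstep : ∀ S : Finset (Finset α × Finset α), (∀ P ∈ S, Large P) →
      ∃ a, ∀ P ∈ S, Large (insert a P.1, P.2) ∧ Large (P.1, insert a P.2) := by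
    intro S hS
    have hb : ∀ P, ∃ g, P ∈ S → g ∈ U P ∧ g ∈ T := by
      intro P
      by_cases h : P ∈ S
      · obtain ⟨g, h1, h2, -⟩ := hT P (hS P h) ∅ Set.countable_empty
        exact ⟨g, fun _ => ⟨h1, h2⟩⟩
      · obtain ⟨g, -⟩ := hD ∅ Set.countable_empty
        exact ⟨g, fun h' => absurd h' h⟩
    choose b hb using hb
    have key : ∀ S' ⊆ S, ∃ D2 : Finset γ, (∀ P ∈ S', ∃ g ∈ D2, g ∈ U P ∧ g ∈ T) ∧
        ∃ a, (∀ f ∈ S.image b, H a f) ∧ (∀ f ∈ D2, L a f) := by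
      intro S'
      induction S' using Finset.induction_on with
      | empty =>
        intro _
        exact ⟨∅, by simp, p, fun f _ => hp f, by simp⟩
      | insert P S' hPS' ih =>
        intro hsub
        obtain ⟨D2, hD2, ha⟩ := ih ((Finset.subset_insert _ _).trans hsub)
        obtain ⟨g, hgU, hgT, hg⟩ := hT P (hS P (hsub (Finset.mem_insert_self _ _)))
          (((S.image b : Finset γ) : Set γ) ∪ (D2 : Set γ))
          (((S.image b).countable_toSet).union D2.countable_toSet)
        obtain ⟨a, ha1, ha2, ha3⟩ := hg (S.image b) D2 Set.subset_union_left Set.subset_union_right ha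
        refine ⟨insert g D2, ?_, a, ha1, ?_⟩
        · intro Q hQ
          rcases Finset.mem_insert.1 hQ with rfl | hQ
          · exact ⟨g, Finset.mem_insert_self _ _, hgU, hgT⟩
          · obtain ⟨g', h1, h2⟩ := hD2 Q hQ
            exact ⟨g', Finset.mem_insert_of_mem h1, h2⟩
        · intro f hf
          rcases Finset.mem_insert.1 hf with rfl | hf
          · exact ha3
          · exact ha2 f hf
    obtain ⟨D2, hD2, a, ha1, ha2⟩ := key S subset_rfl
    refine ⟨a, fun P hP => ⟨?_, ?_⟩⟩
    · apply (hb P hP).2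
      refine ⟨?_, (hb P hP).1.2⟩
      intro a' ha'
      rcases Finset.mem_insert.1 ha' with rfl | h
      · exact ha1 _ (Finset.mem_image_of_mem b hP)
      · exact (hb P hP).1.1 a' h
    · obtain ⟨g, hgD, hgU, hgT⟩ := hD2 P hP
      apply hgT
      refine ⟨hgU.1, ?_⟩
      intro a' ha'
      rcases Finset.mem_insert.1 ha' with rfl | h
      · exact ha2 _ hgD
      · exact hgU.2 a' h
  let St := {S : Finset (Finset α × Finset α) // ∀ P ∈ S, Large P}
  have hstep' : ∀ S : St, ∃ a, ∀ P ∈ S.1, Large (insert a P.1, P.2) ∧ Large (P.1, insert a P.2) :=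
    fun S => hstep S.1 S.2
  choose nx hnx using hstep'
  let s0 : St := ⟨{(∅, ∅)}, by
    intro P hP
    rw [Finset.mem_singleton] at hP
    subst hP
    intro D hDc
    obtain ⟨g, hg⟩ := hD D hDc
    exact ⟨g, ⟨by simp, by simp⟩, hg⟩⟩
  let nxt : St → St := fun S =>
    ⟨S.1.image (fun P => (insert (nx S) P.1, P.2)) ∪ S.1.image (fun P => (P.1, insert (nx S) P.2)), by
      intro P hP
      rcases Finset.mem_union.1 hP with h | h
      · obtain ⟨Q, hQ, rfl⟩ := Finset.mem_image.1 h
        exact (hnx S Q hQ).1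
      · obtain ⟨Q, hQ, rfl⟩ := Finset.mem_image.1 h
        exact (hnx S Q hQ).2⟩
  let sq : ℕ → St := fun n => nxt^[n] s0
  refine ⟨fun n => nx (sq n), fun n P => ?_⟩
  have hinv : ∀ n, ∃ Q ∈ (sq n).1, ∀ i < n, (i ∈ P → nx (sq i) ∈ Q.2) ∧ (i ∉ P → nx (sq i) ∈ Q.1) := by
    intro n
    induction n with
    | zero => exact ⟨(∅, ∅), Finset.mem_singleton_self _, by simp⟩
    | succ n ih =>
      obtain ⟨Q, hQ, hQ'⟩ := ih
      have hsq : sq (n+1) = nxt (sq n) := Function.iterate_succ_apply' nxt n s0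
      rw [hsq]
      by_cases hn : n ∈ P
      · refine ⟨(Q.1, insert (nx (sq n)) Q.2), ?_, ?_⟩
        · exact Finset.mem_union_right _ (Finset.mem_image_of_mem _ hQ)
        · intro i hi
          rcases Nat.lt_succ_iff_lt_or_eq.1 hi with h | rfl
          · exact ⟨fun h' => Finset.mem_insert_of_mem ((hQ' i h).1 h'), (hQ' i h).2⟩
          · exact ⟨fun _ => Finset.mem_insert_self _ _, fun h => absurd hn h⟩
      · refine ⟨(insert (nx (sq n)) Q.1, Q.2), ?_, ?_⟩
        · exact Finset.mem_union_left _ (Finset.mem_image_of_mem _ hQ)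
        · intro i hi
          rcases Nat.lt_succ_iff_lt_or_eq.1 hi with h | rfl
          · exact ⟨(hQ' i h).1, fun h' => Finset.mem_insert_of_mem ((hQ' i h).2 h')⟩
          · exact ⟨fun h => absurd h hn, fun _ => Finset.mem_insert_self _ _⟩
  obtain ⟨Q, hQ, hQ'⟩ := hinv n
  obtain ⟨g, hgU, -⟩ := (sq n).2 Q hQ ∅ Set.countable_empty
  exact ⟨g, fun i hi => ⟨fun h => hgU.2 _ ((hQ' i hi).1 h), fun h => hgU.1 _ ((hQ' i hi).2 h)⟩⟩

/-- Finite net of the unit sphere. -/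
theorem exists_net (𝕜 : Type*) [RCLike 𝕜] (η : ℝ) (hη : 0 < η) :
    ∃ W : Finset 𝕜, W.Nonempty ∧ (∀ w ∈ W, ‖w‖ = 1) ∧
      ∀ c : 𝕜, ∃ w ∈ W, ‖c - (‖c‖ : 𝕜) * w‖ ≤ η * ‖c‖ := by
  have hc : IsCompact (Metric.sphere (0 : 𝕜) 1) := isCompact_sphere 0 1
  obtain ⟨t, ht1, ht2, ht3⟩ := Metric.finite_approx_of_totallyBounded hc.totallyBounded η hη
  have h1 : (1 : 𝕜) ∈ Metric.sphere (0 : 𝕜) 1 := by simp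
  refine ⟨ht2.toFinset, ?_, ?_, ?_⟩
  · have := ht3 h1
    simp only [Set.mem_iUnion] at this
    obtain ⟨w, hw, -⟩ := this
    exact ⟨w, ht2.mem_toFinset.2 hw⟩
  · intro w hw
    simpa using ht1 (ht2.mem_toFinset.1 hw)
  · intro c
    by_cases h0 : c = 0
    · have := ht3 h1
      simp only [Set.mem_iUnion] at this
      obtain ⟨w, hw, -⟩ := this
      exact ⟨w, ht2.mem_toFinset.2 hw, by simp [h0]⟩
    · have hcn : ‖c‖ ≠ 0 := norm_ne_zero_iff.2 h0
      have hcn' : (‖c‖ : 𝕜) ≠ 0 := by exact_mod_cast hcn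
      have : c / (‖c‖ : 𝕜) ∈ Metric.sphere (0 : 𝕜) 1 := by
        simp [hcn]
      have := ht3 this
      simp only [Set.mem_iUnion] at this
      obtain ⟨w, hw, hd⟩ := this
      refine ⟨w, ht2.mem_toFinset.2 hw, ?_⟩
      rw [Metric.mem_ball, dist_eq_norm] at hd
      have e : c - (‖c‖ : 𝕜) * w = (c / (‖c‖ : 𝕜) - w) * (‖c‖ : 𝕜) := by
        field_simp
      rw [e, norm_mul]
      simp only [RCLike.norm_ofReal, abs_norm]
      exact mul_le_mul_of_nonneg_right hd.le (norm_nonneg _)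

open Classical in
/-- Numeric estimate for independent sequences. -/
theorem numeric {𝕜 : Type*} [RCLike 𝕜] {X : Type*} [NormedAddCommGroup X] [NormedSpace 𝕜 X]
    (G : Set (X →L[𝕜] 𝕜)) (hG : ∀ g ∈ G, ‖g‖ ≤ 1) (R s r : ℝ) (hs : 0 < s) 
    (W : Finset 𝕜) (hW0 : W.Nonempty) (hW1 : ∀ w ∈ W, ‖w‖ = 1)
    (hW : ∀ c : 𝕜, ∃ w ∈ W, ‖c - (‖c‖ : 𝕜) * w‖ ≤ s / (2 * R) * ‖c‖) (hR : 0 < R)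
    (hr : r = s / (4 * W.card)) (y : ℕ → X) (hy : ∀ i, ‖y i‖ ≤ R)
    (hpat : ∀ (n : ℕ) (P : Set ℕ), ∃ g ∈ G, ∀ i < n,
      (i ∈ P → RCLike.re (g (y i)) < -s) ∧ (i ∉ P → ‖g (y i)‖ < r))
    (n : ℕ) (c : ℕ → 𝕜) :
    ∃ g ∈ G, r * ∑ i ∈ Finset.range n, ‖c i‖ ≤ ‖g (∑ i ∈ Finset.range n, c i • y i)‖ := by
  choose ω hω1 hω2 using hW
  have hN : 0 < (W.card : ℝ) := by exact_mod_cast hW0.card_pos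
  obtain ⟨w, hw, hwle⟩ : ∃ w ∈ W, (∑ i ∈ Finset.range n, ‖c i‖) / W.card ≤
      ∑ i ∈ Finset.range n with ω (c i) = w, ‖c i‖ := by
    apply Finset.exists_le_of_sum_le hW0
    rw [Finset.sum_fiberwise_of_maps_to (fun i _ => hω1 (c i))]
    rw [Finset.sum_const, nsmul_eq_mul]
    field_simp
    exact le_refl _
  obtain ⟨g, hg, hgp⟩ := hpat n {i | ω (c i) = w}
  refine ⟨g, hg, ?_⟩
  have hgy : ∀ i, ‖g (y i)‖ ≤ R := fun i =>
    (g.le_opNorm _).trans (by nlinarith [hG g hg, hy i, norm_nonneg (y i), norm_nonneg g])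
  have hr0 : 0 < r := by rw [hr]; positivity
  have hterm : ∀ i ∈ Finset.range n,
      (if ω (c i) = w then ‖c i‖ * (s / 2) else 0) - r * ‖c i‖ ≤
        - RCLike.re (starRingEnd 𝕜 w * (c i * g (y i))) := by
    intro i hi
    have hi := Finset.mem_range.1 hi
    split_ifs with h
    · have h1 := (hgp i hi).1 h
      have h2 := hω2 (c i)
      rw [h] at h2
      have hww : starRingEnd 𝕜 w * w = 1 := by
        rw [RCLike.conj_mul, hW1 w hw]; simp
      have e : starRingEnd 𝕜 w * (c i * g (y i)) = (‖c i‖ : 𝕜) * g (y i) +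
          starRingEnd 𝕜 w * (c i - (‖c i‖ : 𝕜) * w) * g (y i) := by
        have : starRingEnd 𝕜 w * (c i - (‖c i‖ : 𝕜) * w) * g (y i) = 
          starRingEnd 𝕜 w * (c i * g (y i)) - (starRingEnd 𝕜 w * w) * ((‖c i‖ : 𝕜) * g (y i)) := by ring
        rw [this, hww]; ring
      rw [e, map_add, RCLike.re_ofReal_mul]
      have h3 : RCLike.re (starRingEnd 𝕜 w * (c i - (‖c i‖ : 𝕜) * w) * g (y i)) ≤ 
          s / 2 * ‖c i‖ := by
        refine (RCLike.re_le_norm _).trans ?_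
        rw [norm_mul, norm_mul, RCLike.norm_conj, hW1 w hw, one_mul]
        calc _ ≤ (s / (2 * R) * ‖c i‖) * R := mul_le_mul h2 (hgy i) (norm_nonneg _) (by positivity)
          _ = _ := by field_simp
      nlinarith [norm_nonneg (c i), mul_nonneg hr0.le (norm_nonneg (c i))]
    · have h1 := (hgp i hi).2 h
      have h3 : RCLike.re (starRingEnd 𝕜 w * (c i * g (y i))) ≤ r * ‖c i‖ := by
        refine (RCLike.re_le_norm _).trans ?_
        rw [norm_mul, norm_mul, RCLike.norm_conj, hW1 w hw, one_mul, mul_comm]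
        exact mul_le_mul_of_nonneg_right h1.le (norm_nonneg _)
      linarith
  have hsum := Finset.sum_le_sum hterm
  rw [Finset.sum_sub_distrib, ← Finset.sum_filter, ← Finset.sum_mul, ← Finset.mul_sum,
    Finset.sum_neg_distrib, ← map_sum, ← Finset.mul_sum] at hsum
  have hfin : - RCLike.re (starRingEnd 𝕜 w * ∑ i ∈ Finset.range n, c i * g (y i)) ≤
      ‖g (∑ i ∈ Finset.range n, c i • y i)‖ := by
    rw [map_sum]
    simp only [map_smul, smul_eq_mul]
    refine (neg_le_abs _).trans ((RCLike.abs_re_le_norm _).trans ?_)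
    rw [norm_mul, RCLike.norm_conj, hW1 w hw, one_mul]
  refine le_trans ?_ (hsum.trans hfin)
  have h5 : (∑ i ∈ Finset.range n, ‖c i‖) / W.card * (s / 2) ≤
     (∑ i ∈ Finset.range n with ω (c i) = w, ‖c i‖) * (s / 2) :=
    mul_le_mul_of_nonneg_right hwle (by positivity)
  have h6 : (∑ i ∈ Finset.range n, ‖c i‖) / W.card * (s / 2) = 
    2 * (r * ∑ i ∈ Finset.range n, ‖c i‖) := by
    rw [hr]; field_simp; ring
  linarith

/-- Operator from `ℓ₁` from a bounded sequence with lower estimates on finite sums. -/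
theorem mkOp {𝕜 : Type*} [RCLike 𝕜] {X : Type*} [NormedAddCommGroup X] [NormedSpace 𝕜 X]
    [CompleteSpace X] (y : ℕ → X) (R : ℝ) (hy : ∀ i, ‖y i‖ ≤ R) :
    ∃ T : lp (fun _ : ℕ => 𝕜) 1 →L[𝕜] X, ∀ v, HasSum (fun i => v i • y i) (T v) := by
  have hR : 0 ≤ R := (norm_nonneg _).trans (hy 0)
  have hn : ∀ v : lp (fun _ : ℕ => 𝕜) 1, HasSum (fun i => ‖v i‖) ‖v‖ := by
    intro v
    simpa using lp.hasSum_norm (p := 1) (by simp) v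
  have hle : ∀ (v : lp (fun _ : ℕ => 𝕜) 1) i, ‖v i • y i‖ ≤ ‖v i‖ * R := by
    intro v i
    rw [norm_smul]
    exact mul_le_mul_of_nonneg_left (hy i) (norm_nonneg _)
  have hsm : ∀ v : lp (fun _ : ℕ => 𝕜) 1, Summable (fun i => v i • y i) := fun v =>
    Summable.of_norm_bounded ((hn v).summable.mul_right R) (hle v)
  let T0 : lp (fun _ : ℕ => 𝕜) 1 →ₗ[𝕜] X :=
    { toFun := fun v => ∑' i, v i • y i
      map_add' := fun v w => by
        rw [← (hsm v).tsum_add (hsm w)]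
        simp [add_smul]
      map_smul' := fun a v => by
        simp only [RingHom.id_apply]
        rw [← (hsm v).tsum_const_smul a]
        simp [mul_smul] }
  refine ⟨T0.mkContinuous R ?_, fun v => (hsm v).hasSum⟩
  intro v
  have := tsum_of_norm_bounded ((hn v).mul_right R) (hle v)
  rw [mul_comm]
  exact this

section Weak

set_option linter.unusedSectionVars false

variable {𝕜 : Type*} [RCLike 𝕜] {X : Type*} [NormedAddCommGroup X]
    [NormedSpace ℝ X] [NormedSpace 𝕜 X] [IsScalarTower ℝ 𝕜 X]

/-- Convex (norm-open) weakly open sets. -/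
structure Nice (𝕜 : Type*) [RCLike 𝕜] {X : Type*} [NormedAddCommGroup X]
    [NormedSpace ℝ X] [NormedSpace 𝕜 X] (V : Set X) : Prop where
  conv : Convex ℝ V
  isOpen : IsOpen V
  weak : ∀ s ∈ V, ∃ F : Finset (X →L[𝕜] 𝕜), ∃ r : ℝ, 0 < r ∧ ∀ x, (∀ f ∈ F, ‖f (x - s)‖ < r) → x ∈ V

theorem Nice.univ : Nice 𝕜 (Set.univ : Set X) :=
  ⟨convex_univ, isOpen_univ, fun _ _ => ⟨∅, 1, one_pos, fun _ _ => trivial⟩⟩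

open Classical in
theorem Nice.inter {V W : Set X} (hV : Nice 𝕜 V) (hW : Nice 𝕜 W) : Nice 𝕜 (V ∩ W) := by
  refine ⟨hV.conv.inter hW.conv, hV.isOpen.inter hW.isOpen, fun s hs => ?_⟩
  obtain ⟨F, r, hr, h⟩ := hV.weak s hs.1
  obtain ⟨F', r', hr', h'⟩ := hW.weak s hs.2
  refine ⟨F ∪ F', min r r', lt_min hr hr', fun x hx => ⟨h x ?_, h' x ?_⟩⟩
  · exact fun f hf => (hx f (Finset.mem_union_left _ hf)).trans_le (min_le_left _ _)
  · exact fun f hf => (hx f (Finset.mem_union_right _ hf)).trans_le (min_le_right _ _)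

theorem Nice.biInter {ι : Type*} {t : Set ι} (ht : t.Finite) {V : ι → Set X}
    (hV : ∀ i, Nice 𝕜 (V i)) : Nice 𝕜 {x | ∀ i ∈ t, x ∈ V i} := by
  induction t, ht using Set.Finite.induction_on with
  | empty => simpa using (Nice.univ : Nice 𝕜 (Set.univ : Set X))
  | insert _ _ ih =>
    rename_i a t _ _
    have : {x | ∀ i ∈ insert a t, x ∈ V i} = V a ∩ {x | ∀ i ∈ t, x ∈ V i} := by
      ext x; simp
    rw [this]
    exact (hV a).inter ih

theorem re_smul_real (f : X →L[𝕜] 𝕜) (a : ℝ) (x : X) :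
    f (a • x) = (a : 𝕜) * f x := by
  rw [← smul_one_smul 𝕜 a x, map_smul, smul_eq_mul, RCLike.real_smul_eq_coe_mul, mul_one]

theorem Nice.half (f : X →L[𝕜] 𝕜) (c : ℝ) : Nice 𝕜 {x : X | c < RCLike.re (f x)} := by
  refine ⟨?_, ?_, ?_⟩
  · intro x hx y hy a b ha hb hab
    simp only [Set.mem_ofPred_eq, map_add, re_smul_real, RCLike.re_ofReal_mul] at *
    rcases eq_or_lt_of_le ha with rfl | ha
    · have : b = 1 := by linarith
      subst this; simpa using hy
    · have : a * c + b * c = c := by rw [← add_mul, hab, one_mul]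
      nlinarith [mul_lt_mul_of_pos_left hx ha, mul_le_mul_of_nonneg_left (le_of_lt hy) hb]
  · exact isOpen_lt continuous_const (RCLike.continuous_re.comp f.continuous)
  · intro s hs
    refine ⟨{f}, RCLike.re (f s) - c, sub_pos.2 hs, fun x hx => ?_⟩
    have h1 := hx f (Finset.mem_singleton_self f)
    have h2 := (RCLike.abs_re_le_norm (f (x - s))).trans_lt h1
    rw [map_sub, map_sub] at h2
    have := (abs_lt.1 h2).1
    simp only [Set.mem_ofPred_eq]
    linarith

theorem Nice.low (f : X →L[𝕜] 𝕜) (p : X) (s : ℝ) :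
    Nice 𝕜 {x : X | RCLike.re (f (x - p)) < -s} := by
  have := Nice.half (-f) (s - RCLike.re (f p))
  convert this using 2
  ext x
  simp only [map_sub, neg_apply, map_neg]
  constructor <;> intro h <;> linarith

theorem Nice.disk (f : X →L[𝕜] 𝕜) (p : X) (r : ℝ) :
    Nice 𝕜 {x : X | ‖f (x - p)‖ < r} := by
  refine ⟨?_, ?_, ?_⟩
  · intro x hx y hy a b ha hb hab
    simp only [Set.mem_ofPred_eq] at *
    have e : f (a • x + b • y - p) = (a : 𝕜) * f (x - p) + (b : 𝕜) * f (y - p) := by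
      have : (a : 𝕜) + b = 1 := by exact_mod_cast hab
      rw [map_sub, map_add, re_smul_real, re_smul_real, map_sub, map_sub]
      linear_combination (-f p) * (-this)
    rw [e]
    refine (norm_add_le _ _).trans_lt ?_
    rw [norm_mul, norm_mul, RCLike.norm_ofReal, RCLike.norm_ofReal, abs_of_nonneg ha, abs_of_nonneg hb]
    rcases eq_or_lt_of_le ha with rfl | ha
    · have : b = 1 := by linarith
      subst this; simpa using hy
    · have : a * r + b * r = r := by rw [← add_mul, hab, one_mul]
      nlinarith [mul_lt_mul_of_pos_left hx ha, mul_le_mul_of_nonneg_left (le_of_lt hy) hb]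
  · exact isOpen_lt (by fun_prop) continuous_const
  · intro s hs
    refine ⟨{f}, r - ‖f (s - p)‖, sub_pos.2 hs, fun x hx => ?_⟩
    have h1 := hx f (Finset.mem_singleton_self f)
    have e : f (x - p) = f (x - s) + f (s - p) := by simp
    simp only [Set.mem_ofPred_eq]
    rw [e]
    have := norm_add_le (f (x - s)) (f (s - p))
    linarith

/-- `A` is weakly countably determined. -/
def WCD (𝕜 : Type*) [RCLike 𝕜] {X : Type*} [NormedAddCommGroup X]
    [NormedSpace ℝ X] [NormedSpace 𝕜 X] (A : Set X) : Prop :=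
  ∃ C : Set (Set X), C.Countable ∧ (∀ V ∈ C, Nice 𝕜 V ∧ (A ∩ V).Nonempty) ∧
    ∀ p ∈ A, ∀ (f : X →L[𝕜] 𝕜) (ε : ℝ), 0 < ε →
      ∃ V ∈ C, ∀ x ∈ A, x ∈ V → RCLike.re (f p) - ε < RCLike.re (f x)

/-- The quotient by `Y` has no copy of `ℓ₁` (phrased in `X`). -/
def HasL1 {𝕜 : Type*} [RCLike 𝕜] {X : Type*} [NormedAddCommGroup X]
    [NormedSpace 𝕜 X] (Y : Submodule 𝕜 X) : Prop :=
  ∃ T : lp (fun _ : ℕ => 𝕜) 1 →L[𝕜] X, ∃ c : ℝ, 0 < c ∧ ∀ v, ∀ y ∈ Y, c * ‖v‖ ≤ ‖T v - y‖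

theorem hasL1_of_patterns [CompleteSpace X] (Y : Submodule 𝕜 X) (G : Set (X →L[𝕜] 𝕜))
    (hG : ∀ g ∈ G, ‖g‖ ≤ 1 ∧ ∀ y ∈ Y, g y = 0) (y : ℕ → X) (R : ℝ) (hy : ∀ i, ‖y i‖ ≤ R)
    (r : ℝ) (hr : 0 < r) (h : ∀ (n : ℕ) (c : ℕ → 𝕜), ∃ g ∈ G,
      r * ∑ i ∈ Finset.range n, ‖c i‖ ≤ ‖g (∑ i ∈ Finset.range n, c i • y i)‖) : HasL1 Y := by
  obtain ⟨T, hT⟩ := mkOp (𝕜 := 𝕜) y R hy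
  refine ⟨T, r, hr, fun v z hz => ?_⟩
  have h1 : Filter.Tendsto (fun n => r * ∑ i ∈ Finset.range n, ‖v i‖) Filter.atTop (𝓝 (r * ‖v‖)) := by
    have : HasSum (fun i => ‖v i‖) ‖v‖ := by simpa using lp.hasSum_norm (p := 1) (by simp) v
    exact this.tendsto_sum_nat.const_mul r
  have h2 : Filter.Tendsto (fun n => ‖∑ i ∈ Finset.range n, v i • y i - z‖) Filter.atTop
      (𝓝 (‖T v - z‖)) := ((hT v).tendsto_sum_nat.sub_const z).norm
  refine le_of_tendsto_of_tendsto' h1 h2 fun n => ?_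
  obtain ⟨g, hg, hle⟩ := h n v
  refine hle.trans ?_
  have e : g (∑ i ∈ Finset.range n, v i • y i) = g (∑ i ∈ Finset.range n, v i • y i - z) := by
    rw [map_sub g _ z, (hG g hg).2 z hz, sub_zero]
  rw [e]
  refine (g.le_opNorm _).trans ?_
  exact mul_le_of_le_one_left (norm_nonneg _) (hG g hg).1

/-- The key dichotomy. -/
theorem keyR [CompleteSpace X] [TopologicalSpace.SeparableSpace X] (Y : Submodule 𝕜 X)
    (hno : ¬ HasL1 Y) (A : Set X) (hA : IsBounded A) (p : X) (hp : p ∈ A) (s : ℝ) (hs : 0 < s) :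
    ∃ C : Set (Set X), C.Countable ∧ (∀ V ∈ C, Nice 𝕜 V ∧ (A ∩ V).Nonempty) ∧
      ∀ g : X →L[𝕜] 𝕜, ‖g‖ ≤ 1 → (∀ y ∈ Y, g y = 0) →
        ∃ V ∈ C, ∀ x ∈ A, x ∈ V → -s ≤ RCLike.re (g (x - p)) := by
  by_contra hcon
  push Not at hcon
  apply hno
  obtain ⟨R0, hR0⟩ := hA.exists_norm_le
  set R : ℝ := 2 * |R0| + 1 with hRdef
  have hR : 0 < R := by positivity
  have hAR : ∀ x ∈ A, ‖x - p‖ ≤ R := by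
    intro x hx
    have := norm_sub_le x p
    have := hR0 x hx
    have := hR0 p hp
    have := le_abs_self R0
    linarith
  obtain ⟨W, hW0, hW1, hW⟩ := exists_net 𝕜 (s / (2 * R)) (by positivity)
  have hN : 0 < (W.card : ℝ) := by exact_mod_cast hW0.card_pos
  set r := s / (4 * W.card) with hr
  have hr0 : 0 < r := by positivity
  obtain ⟨A0, hA0A, hA0c, hA0d⟩ := 
    (TopologicalSpace.IsSeparable.of_separableSpace A).exists_countable_dense_subset
  have hdense : ∀ V : Set X, IsOpen V → (A ∩ V).Nonempty → ∃ x ∈ insert p A0, x ∈ V := by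
    intro V hV ⟨x, hxA, hxV⟩
    obtain ⟨z, hz1, hz2⟩ := mem_closure_iff.1 (hA0d hxA) V hV hxV
    exact ⟨z, Set.mem_insert_of_mem _ hz2, hz1⟩
  let γ := {g : X →L[𝕜] 𝕜 // ‖g‖ ≤ 1 ∧ ∀ y ∈ Y, g y = 0}
  let α := ↥(insert p A0)
  have : Countable α := (hA0c.insert p).to_subtype
  have hαA : ∀ a : α, (a : X) ∈ A := by
    rintro ⟨a, ha⟩
    rcases ha with rfl | ha
    · exact hp
    · exact hA0A ha
  let Vs : Set γ × Set γ → Set X := fun t =>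
    {x | ∀ g ∈ t.1, x ∈ {x : X | ‖g.1 (x - p)‖ < r}} ∩
      {x | ∀ g ∈ t.2, x ∈ {x : X | RCLike.re (g.1 (x - p)) < -s}}
  have hVs : ∀ t : Set γ × Set γ, t.1.Finite → t.2.Finite → Nice 𝕜 (Vs t) := fun t h1 h2 =>
    (Nice.biInter h1 fun g : γ => Nice.disk g.1 p r).inter
      (Nice.biInter h2 fun g : γ => Nice.low g.1 p s)
  obtain ⟨a, ha⟩ := comb (α := α) (γ := γ) (fun a g => ‖g.1 ((a : X) - p)‖ < r)
    (fun a g => RCLike.re (g.1 ((a : X) - p)) < -s) ⟨p, Set.mem_insert _ _⟩ (by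
      intro g; simpa using hr0) (by
      intro D hD
      have hcount := Set.countable_ofPred_finite_subset hD
      obtain ⟨g, hg1, hg2, hg⟩ := hcon
        ((Vs '' ({t | t.Finite ∧ t ⊆ D} ×ˢ {t | t.Finite ∧ t ⊆ D})) ∩ {V | (A ∩ V).Nonempty})
        (((hcount.prod hcount).image _).mono Set.inter_subset_left) (by
          rintro V ⟨⟨t, ht, rfl⟩, hV⟩
          exact ⟨hVs t ht.1.1 ht.2.1, hV⟩)
      refine ⟨⟨g, hg1, hg2⟩, ?_⟩
      rintro D1 D2 hD1 hD2 ⟨a, ha1, ha2⟩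
      obtain ⟨x, hxA, hxV, hx⟩ := hg (Vs (D1, D2)) ⟨⟨((D1 : Set γ), (D2 : Set γ)),
        ⟨⟨D1.finite_toSet, hD1⟩, ⟨D2.finite_toSet, hD2⟩⟩, rfl⟩, ⟨a, hαA a, fun f hf => ha1 f hf,
          fun f hf => ha2 f hf⟩⟩
      obtain ⟨z, hz1, hz2⟩ := hdense (Vs (D1, D2) ∩ {x : X | RCLike.re (g (x - p)) < -s})
        ((hVs (D1, D2) D1.finite_toSet D2.finite_toSet).inter (Nice.low g p s)).isOpen
        ⟨x, hxA, hxV, hx⟩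
      exact ⟨⟨z, hz1⟩, fun f hf => hz2.1.1 f hf, fun f hf => hz2.1.2 f hf, hz2.2⟩)
  refine hasL1_of_patterns Y {g | ‖g‖ ≤ 1 ∧ ∀ y ∈ Y, g y = 0} (fun g hg => hg)
    (fun i => (a i : X) - p) R (fun i => hAR _ (hαA _)) r hr0 ?_
  refine numeric _ (fun g hg => hg.1) R s r hs W hW0 hW1 hW hR hr _ (fun i => hAR _ (hαA _)) ?_
  intro n P
  obtain ⟨g, hg⟩ := ha n P
  exact ⟨g.1, g.2, hg⟩

theorem wcd_open [CompleteSpace X] [TopologicalSpace.SeparableSpace X] (Y : Submodule 𝕜 X)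
    (hno : ¬ HasL1 Y) (A : Set X) (hA : IsBounded A) (hAc : Convex ℝ A) (hAo : IsOpen A)
    (hY : ∀ p ∈ A, WCD 𝕜 {x | x ∈ A ∧ x - p ∈ Y}) : WCD 𝕜 A := by
  obtain ⟨A0, hA0A, hA0c, hA0d⟩ :=
    (TopologicalSpace.IsSeparable.of_separableSpace A).exists_countable_dense_subset
  have hY' : ∀ p : A, WCD 𝕜 {x | x ∈ A ∧ x - p ∈ Y} := fun p => hY p p.2
  choose C hCc hCn hCd using hY'
  have hR : ∀ (p : A) (W : Set X) (k : ℕ), ∃ D : Set (Set X), D.Countable ∧ (W ∈ C p →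
      ∃ σ ∈ A, σ - p ∈ Y ∧ σ ∈ W ∧ (∀ V ∈ D, Nice 𝕜 V ∧ ((A ∩ W) ∩ V).Nonempty) ∧
      ∀ g : X →L[𝕜] 𝕜, ‖g‖ ≤ 1 → (∀ y ∈ Y, g y = 0) →
        ∃ V ∈ D, ∀ x ∈ A ∩ W, x ∈ V → -(1 / ((k : ℝ) + 1)) ≤ RCLike.re (g (x - σ))) := by
    intro p W k
    by_cases hW : W ∈ C p
    · obtain ⟨σ, ⟨hσA, hσY⟩, hσW⟩ := (hCn p W hW).2
      obtain ⟨D, hD1, hD2, hD3⟩ := keyR Y hno (A ∩ W) (hA.subset Set.inter_subset_left) σ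
        ⟨hσA, hσW⟩ (1 / ((k : ℝ) + 1)) (by positivity)
      exact ⟨D, hD1, fun _ => ⟨σ, hσA, hσY, hσW, hD2, hD3⟩⟩
    · exact ⟨∅, Set.countable_empty, fun h => absurd h hW⟩
  choose D hDc hD using hR
  refine ⟨⋃ p ∈ {p : A | (p : X) ∈ A0}, ⋃ W ∈ C p, ⋃ k, (fun V => W ∩ V) '' D p W k, ?_, ?_, ?_⟩
  · refine Set.Countable.biUnion (hA0c.preimage Subtype.coe_injective) fun p _ => ?_
    refine Set.Countable.biUnion (hCc p) fun W _ => ?_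
    exact Set.countable_iUnion fun k => (hDc p W k).image _
  · intro V hV
    simp only [Set.mem_iUnion] at hV
    obtain ⟨p, hp, W, hW, k, V, hV, rfl⟩ := hV
    obtain ⟨σ, hσA, hσY, hσW, h1, h2⟩ := hD p W k hW
    refine ⟨(hCn p W hW).1.inter (h1 V hV).1, ?_⟩
    obtain ⟨x, hx⟩ := (h1 V hV).2
    exact ⟨x, hx.1.1, hx.1.2, hx.2⟩
  · intro p' hp' f ε hε
    -- choose `p` in the dense set
    obtain ⟨p, hpf, hpA0⟩ := mem_closure_iff.1 (hA0d hp') _ (Nice.half f (RCLike.re (f p') - ε / 4)).isOpen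
      (by simp only [Set.mem_ofPred_eq]; linarith)
    simp only [Set.mem_ofPred_eq] at hpf
    have hpA : p ∈ A := hA0A hpA0
    obtain ⟨W, hW, hWf⟩ := hCd ⟨p, hpA⟩ p ⟨hpA, by simp⟩ f (ε / 4) (by linarith)
    have hWn : Nice 𝕜 W := (hCn ⟨p, hpA⟩ W hW).1
    -- it suffices to find `k`, `V`
    suffices h : ∃ k, ∃ V ∈ D ⟨p, hpA⟩ W k, ∀ x ∈ A, x ∈ W → x ∈ V →
        RCLike.re (f p) - ε / 2 ≤ RCLike.re (f x) by
      obtain ⟨k, V, hV, h⟩ := h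
      refine ⟨W ∩ V, ?_, fun x hxA hx => ?_⟩
      · simp only [Set.mem_iUnion]
        exact ⟨⟨p, hpA⟩, hpA0, W, hW, k, V, hV, rfl⟩
      · have := h x hxA hx.1 hx.2
        linarith
    let Cs : Set X := (A ∩ W) ∩ {x | RCLike.re (f (x - p)) < -(ε / 4)}
    have hCsn : Convex ℝ Cs := (hAc.inter hWn.conv).inter (Nice.low f p _).conv
    have hCso : IsOpen Cs := (hAo.inter hWn.isOpen).inter (Nice.low f p _).isOpen
    by_cases hne : Cs.Nonempty
    swap
    · obtain ⟨σ, hσA, hσY, hσW, h1, h2⟩ := hD ⟨p, hpA⟩ W 0 hW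
      obtain ⟨V, hV, -⟩ := h2 0 (by simp) (by simp)
      refine ⟨0, V, hV, fun x hxA hxW _ => ?_⟩
      by_contra hx
      apply hne
      refine ⟨x, ⟨hxA, hxW⟩, ?_⟩
      simp only [Set.mem_ofPred_eq, map_sub]
      linarith
    obtain ⟨x0, hx0⟩ := hne
    let S : Set X := {x | x - p ∈ Y}
    have hSc : Convex ℝ S := by
      intro x hx y hy a b ha hb hab
      have e : a • x + b • y - p = ((a : 𝕜)) • (x - p) + ((b : 𝕜)) • (y - p) := by
        have h1 : ((a : 𝕜)) • (x - p) = a • (x - p) := by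
          rw [← smul_one_smul 𝕜 a (x - p), RCLike.real_smul_eq_coe_mul, mul_one]
        have h2 : ((b : 𝕜)) • (y - p) = b • (y - p) := by
          rw [← smul_one_smul 𝕜 b (y - p), RCLike.real_smul_eq_coe_mul, mul_one]
        rw [h1, h2]
        have : a • p + b • p = p := by rw [← add_smul, hab, one_smul]
        rw [smul_sub, smul_sub]
        nth_rewrite 1 [← this]
        abel
      change a • x + b • y - p ∈ Y
      rw [e]
      exact Y.add_mem (Y.smul_mem _ hx) (Y.smul_mem _ hy)
    have hdisj : Disjoint Cs S := by
      rw [Set.disjoint_left]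
      rintro x ⟨⟨hxA, hxW⟩, hxl⟩ hxS
      have := hWf x ⟨hxA, hxS⟩ hxW
      simp only [Set.mem_ofPred_eq, map_sub] at hxl
      linarith
    obtain ⟨h, u, hu1, hu2⟩ := RCLike.geometric_hahn_banach_open (𝕜 := 𝕜) hCsn hCso hSc hdisj
    have hhY : ∀ y ∈ Y, h y = 0 := by
      intro y hy
      by_contra hy0
      have h1 := hu2 (p + (((u - 1 - RCLike.re (h p) : ℝ) : 𝕜) / h y) • y) (by
        simp only [S, Set.mem_ofPred_eq, add_sub_cancel_left]
        exact Y.smul_mem _ hy)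
      rw [map_add, map_smul, smul_eq_mul, div_mul_cancel₀ _ hy0, map_add, RCLike.ofReal_re] at h1
      linarith
    have hup : u ≤ RCLike.re (h p) := hu2 p (by simp [S])
    have hneg : ∀ x ∈ Cs, RCLike.re (h (x - p)) < 0 := by
      intro x hx
      have := hu1 x hx
      rw [map_sub, map_sub]
      linarith
    -- lower bound data
    obtain ⟨σ, hσA, hσY, hσW, -⟩ := hD ⟨p, hpA⟩ W 0 hW
    have hκ : ∃ κ > 0, ∀ x ∈ A, x ∈ W → RCLike.re (f x) < RCLike.re (f p) - ε / 2 →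
        RCLike.re (h (x - p)) ≤ -κ := by
      set v := p - x0 with hv
      have hhv : 0 < RCLike.re (h v) := by
        have := hneg x0 hx0
        rw [map_sub, map_sub] at this
        rw [hv, map_sub, map_sub]
        linarith
      have hcont : Filter.Tendsto (fun τ : ℝ => σ + τ • v) (𝓝 0) (𝓝 σ) := by
        have : Continuous (fun τ : ℝ => σ + τ • v) := by fun_prop
        simpa using this.tendsto 0
      have hev := hcont.eventually ((hAo.inter hWn.isOpen).mem_nhds ⟨hσA, hσW⟩)
      obtain ⟨τ, hτ0, hτ⟩ : ∃ τ : ℝ, 0 < τ ∧ σ + τ • v ∈ A ∩ W := by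
        have h1 := (hev.filter_mono nhdsWithin_le_nhds : ∀ᶠ τ in 𝓝[>] (0 : ℝ), _)
        obtain ⟨τ, h2, h3⟩ := (h1.and self_mem_nhdsWithin).exists
        exact ⟨τ, h3, h2⟩
      obtain ⟨R, hR⟩ := hA.exists_norm_le
      set K : ℝ := 2 * (‖f‖ * |R|) + 1 with hK
      have hKpos : 0 < K := by positivity
      have hfR : ∀ x ∈ A, |RCLike.re (f x)| ≤ ‖f‖ * |R| := fun x hx =>
        (RCLike.abs_re_le_norm _).trans ((f.le_opNorm x).trans
          (mul_le_mul_of_nonneg_left ((hR x hx).trans (le_abs_self R)) (norm_nonneg _)))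
      obtain ⟨t, ht0, ht1, htK⟩ : ∃ t : ℝ, 0 < t ∧ t < 1 ∧ t * K ≤ ε / 4 := by
        refine ⟨min (1 / 2) (ε / 4 / K), lt_min (by norm_num) (by positivity),
          (min_le_left _ _).trans_lt (by norm_num), ?_⟩
        calc _ ≤ ε / 4 / K * K := mul_le_mul_of_nonneg_right (min_le_right _ _) hKpos.le
          _ = ε / 4 := by field_simp
      refine ⟨t * τ * RCLike.re (h v), by positivity, fun x hxA hxW hxf => ?_⟩
      have hm : (1 - t) • x + t • (σ + τ • v) ∈ Cs := by
        refine ⟨(hAc.inter hWn.conv) ⟨hxA, hxW⟩ hτ (by linarith) ht0.le (by ring), ?_⟩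
        simp only [Set.mem_ofPred_eq]
        rw [map_sub, map_add f, re_smul_real f (1 - t), re_smul_real f t, map_sub, map_add,
          RCLike.re_ofReal_mul, RCLike.re_ofReal_mul]
        have h1 := (abs_le.1 (hfR x hxA)).1
        have h2 := (abs_le.1 (hfR _ hτ.1)).2
        have h3 : t * (RCLike.re (f (σ + τ • v)) - RCLike.re (f x)) ≤ t * K :=
          mul_le_mul_of_nonneg_left (by linarith) ht0.le
        linarith
      have h4 := hneg _ hm
      have hσ : h σ = h p := by
        have := hhY _ hσY
        rw [map_sub, sub_eq_zero] at this
        exact this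
      rw [map_sub, map_add h, re_smul_real h (1 - t), re_smul_real h t, map_add h, re_smul_real h τ, hσ,
        map_sub, map_add, RCLike.re_ofReal_mul, RCLike.re_ofReal_mul, map_add, RCLike.re_ofReal_mul] at h4
      rw [map_sub, map_sub]
      have h5 : 0 < t * (τ * RCLike.re (h v)) := by positivity
      by_contra hc
      push Not at hc
      nlinarith [mul_pos ht0 h5]
    obtain ⟨κ, hκ0, hκ⟩ := hκ
    have hh0 : 0 < ‖h‖ := by
      rw [norm_pos_iff]
      rintro rfl
      have := hneg x0 hx0
      simp at this
    obtain ⟨k, hk⟩ := exists_nat_one_div_lt (show 0 < κ / ‖h‖ by positivity)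
    obtain ⟨σ', hσA', hσY', hσW', -, h2⟩ := hD ⟨p, hpA⟩ W k hW
    obtain ⟨V, hV, hVx⟩ := h2 (((‖h‖⁻¹ : ℝ) : 𝕜) • h) (by
      rw [norm_smul, RCLike.norm_ofReal, abs_of_nonneg (by positivity)]
      exact (inv_mul_cancel₀ hh0.ne').le) (by
      intro y hy
      simp [hhY y hy])
    refine ⟨k, V, hV, fun x hxA hxW hxV => ?_⟩
    by_contra hc
    push Not at hc
    have h6 := hκ x hxA hxW hc
    have h7 := hVx x ⟨hxA, hxW⟩ hxV
    have e : h (x - σ') = h (x - p) := by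
      have := hhY _ hσY'
      rw [map_sub, sub_eq_zero] at this
      rw [map_sub, map_sub, this]
    rw [smul_apply, smul_eq_mul, RCLike.re_ofReal_mul, e] at h7
    have h8 : ‖h‖⁻¹ * RCLike.re (h (x - p)) ≤ ‖h‖⁻¹ * (-κ) :=
      mul_le_mul_of_nonneg_left h6 (by positivity)
    have h9 : ‖h‖⁻¹ * (-κ) = -(κ / ‖h‖) := by field_simp
    linarith

theorem lp_sub_le (v w : lp (fun _ : ℕ => 𝕜) 1) (n : ℕ) :
    ‖v - w‖ ≤ ∑ i ∈ Finset.range n, ‖v i - w i‖ + (‖v‖ - ∑ i ∈ Finset.range n, ‖v i‖) +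
      (‖w‖ - ∑ i ∈ Finset.range n, ‖w i‖) := by
  have hn : ∀ v : lp (fun _ : ℕ => 𝕜) 1, HasSum (fun i => ‖v i‖) ‖v‖ := by
    intro v
    simpa using lp.hasSum_norm (p := 1) (by simp) v
  have hs : ∀ v : lp (fun _ : ℕ => 𝕜) 1,
      ∑ i ∈ Finset.range n, ‖v i‖ + ∑' i, ‖v (i + n)‖ = ‖v‖ := by
    intro v
    rw [(hn v).summable.sum_add_tsum_nat_add n, (hn v).tsum_eq]
  have hsm : ∀ v : lp (fun _ : ℕ => 𝕜) 1, Summable fun i => ‖v (i + n)‖ := fun v =>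
    (summable_nat_add_iff n).2 (hn v).summable
  have h1 := hs v
  have h2 := hs w
  have h3 := hs (v - w)
  have h4 : ∑' i, ‖(v - w) (i + n)‖ ≤ ∑' i, ‖v (i + n)‖ + ∑' i, ‖w (i + n)‖ := by
    rw [← (hsm v).tsum_add (hsm w)]
    refine (hsm _).tsum_le_tsum (fun i => ?_) ((hsm v).add (hsm w))
    rw [lp.coeFn_sub, Pi.sub_apply]
    exact norm_sub_le _ _
  have h5 : ∑ i ∈ Finset.range n, ‖(v - w) i‖ = ∑ i ∈ Finset.range n, ‖v i - w i‖ := by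
    simp
  rw [h5] at h3
  linarith

open Classical in
theorem wcd_fibre [TopologicalSpace.SeparableSpace X] (Y : Submodule 𝕜 X)
    (e : lp (fun _ : ℕ => 𝕜) 1 ≃L[𝕜] Y) (A : Set X) (hA : IsBounded A) (p : X) :
    WCD 𝕜 {x | x ∈ A ∧ x - p ∈ Y} := by
  set Fp : Set X := {x | x ∈ A ∧ x - p ∈ Y} with hFp
  -- small weakly open sets
  have hsmall : ∀ W : Set X, Nice 𝕜 W → (Fp ∩ W).Nonempty → ∀ δ > 0, ∃ V, Nice 𝕜 V ∧
      ∃ σ ∈ Fp, σ ∈ V ∧ σ ∈ W ∧ ∀ x ∈ Fp, x ∈ V → ‖x - σ‖ < δ := by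
    intro W hW hne δ hδ
    let E : lp (fun _ : ℕ => 𝕜) 1 →L[𝕜] Y := e
    let E' : Y →L[𝕜] lp (fun _ : ℕ => 𝕜) 1 := e.symm
    have hco : ∀ i : ℕ, ∃ ψ : X →L[𝕜] 𝕜, ∀ z : Y, ψ z = (e.symm z) i := by
      intro i
      let l : Y →ₗ[𝕜] 𝕜 :=
        { toFun := fun z => (e.symm z) i
          map_add' := fun a b => by simp
          map_smul' := fun a b => by simp }
      obtain ⟨g, hg, -⟩ := exists_extension_norm_eq Y (l.mkContinuous ‖E'‖ (fun z =>
        (lp.norm_apply_le_norm (by simp) (e.symm z) i).trans (E'.le_opNorm z)))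
      exact ⟨g, fun z => hg z⟩
    choose ψ hψ using hco
    obtain ⟨R, hR⟩ := hA.exists_norm_le
    let N : X → ℝ := fun x => if h : x - p ∈ Y then ‖e.symm ⟨x - p, h⟩‖ else 0
    have hN : ∀ x (h : x - p ∈ Y), N x = ‖e.symm ⟨x - p, h⟩‖ := fun x h => dif_pos h
    have hbdd : BddAbove (N '' (Fp ∩ W)) := by
      refine ⟨‖E'‖ * (R + ‖p‖), ?_⟩
      rintro _ ⟨x, ⟨⟨hxA, hxY⟩, hxW⟩, rfl⟩
      rw [hN x hxY]
      refine (E'.le_opNorm _).trans (mul_le_mul_of_nonneg_left ?_ (norm_nonneg _))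
      exact (norm_sub_le x p).trans (by linarith [hR x hxA])
    set δ' := δ / (5 * (‖E‖ + 1)) with hδ'
    have hδ'0 : 0 < δ' := by positivity
    obtain ⟨_, ⟨σ, ⟨⟨hσA, hσY⟩, hσW⟩, rfl⟩, hσ⟩ :=
      exists_lt_of_lt_csSup (hne.image N) (sub_lt_self (sSup (N '' (Fp ∩ W))) hδ'0)
    set M := sSup (N '' (Fp ∩ W)) with hM
    rw [hN σ hσY] at hσ
    have hsum : HasSum (fun i => ‖(e.symm ⟨σ - p, hσY⟩) i‖) ‖e.symm ⟨σ - p, hσY⟩‖ := by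
      simpa using lp.hasSum_norm (p := 1) (by simp) (e.symm ⟨σ - p, hσY⟩)
    obtain ⟨n, hn⟩ := (hsum.tendsto_sum_nat.eventually (lt_mem_nhds hσ)).exists
    have hVn : Nice 𝕜 (W ∩ {x | ∀ i ∈ {i | i < n}, x ∈ {x : X | ‖ψ i (x - σ)‖ < δ' / (n + 1)}}) :=
      hW.inter (Nice.biInter (Set.finite_lt_nat n) fun i => Nice.disk (ψ i) σ _)
    refine ⟨_, hVn, σ, ⟨hσA, hσY⟩, ⟨hσW, ?_⟩, hσW, ?_⟩
    · intro i _
      simp only [Set.mem_ofPred_eq, sub_self, map_zero, norm_zero]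
      positivity
    · rintro x ⟨hxA, hxY⟩ ⟨hxW, hxψ⟩
      set v := e.symm ⟨x - p, hxY⟩ with hv
      set w := e.symm ⟨σ - p, hσY⟩ with hw
      have hvM : ‖v‖ ≤ M := by
        rw [hv, ← hN x hxY]
        exact le_csSup hbdd ⟨x, ⟨⟨hxA, hxY⟩, hxW⟩, rfl⟩
      have hwM : ‖w‖ ≤ M := by
        rw [hw, ← hN σ hσY]
        exact le_csSup hbdd ⟨σ, ⟨⟨hσA, hσY⟩, hσW⟩, rfl⟩
      have hc : ∀ i < n, ‖v i - w i‖ ≤ δ' / (n + 1) := by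
        intro i hi
        have h1 := hxψ i hi
        simp only [Set.mem_ofPred_eq] at h1
        have e1 : x - σ = ((⟨x - p, hxY⟩ : Y) : X) - ((⟨σ - p, hσY⟩ : Y) : X) := by simp
        rw [e1, map_sub, hψ, hψ] at h1
        exact h1.le
      have h1 : ∑ i ∈ Finset.range n, ‖v i - w i‖ ≤ δ' := by
        calc _ ≤ ∑ i ∈ Finset.range n, δ' / ((n : ℝ) + 1) :=
              Finset.sum_le_sum fun i hi => hc i (Finset.mem_range.1 hi)
          _ = n * (δ' / ((n : ℝ) + 1)) := by simp
          _ = δ' * (n / ((n : ℝ) + 1)) := by ring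
          _ ≤ δ' * 1 := by
              apply mul_le_mul_of_nonneg_left _ hδ'0.le
              rw [div_le_one (by positivity)]
              linarith
          _ = δ' := mul_one _
      have h2 : ∑ i ∈ Finset.range n, ‖w i‖ ≤
          ∑ i ∈ Finset.range n, ‖v i‖ + ∑ i ∈ Finset.range n, ‖v i - w i‖ := by
        rw [← Finset.sum_add_distrib]
        refine Finset.sum_le_sum fun i _ => ?_
        have := norm_sub_le (v i) (v i - w i)
        simpa using this
      have h3 := lp_sub_le v w n
      have h4 : ‖v - w‖ ≤ 5 * δ' := by linarith
      have e2 : x - σ = ((E (v - w) : Y) : X) := by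
        simp [E, hv, hw]
      rw [e2]
      change ‖E (v - w)‖ < δ
      refine (E.le_opNorm _).trans_lt ?_
      calc ‖E‖ * ‖v - w‖ ≤ ‖E‖ * (5 * δ') := mul_le_mul_of_nonneg_left h4 (norm_nonneg _)
        _ < (‖E‖ + 1) * (5 * δ') := by
            apply mul_lt_mul_of_pos_right (by linarith) (by positivity)
        _ = δ := by rw [hδ']; field_simp
  obtain ⟨Q, hQc, hQd⟩ := TopologicalSpace.exists_countable_dense X
  have hex : ∀ (d : X) (k : ℕ), ∃ D : Set (Set X), D.Countable ∧
      (∀ V ∈ D, Nice 𝕜 V ∧ (Fp ∩ V).Nonempty ∧ ∀ x ∈ Fp, x ∈ V → ‖x - d‖ < 1 / ((k : ℝ) + 1)) ∧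
      ((∃ V, Nice 𝕜 V ∧ (Fp ∩ V).Nonempty ∧ ∀ x ∈ Fp, x ∈ V → ‖x - d‖ < 1 / ((k : ℝ) + 1)) →
        D.Nonempty) := by
    intro d k
    by_cases h : ∃ V, Nice 𝕜 V ∧ (Fp ∩ V).Nonempty ∧ ∀ x ∈ Fp, x ∈ V → ‖x - d‖ < 1 / ((k : ℝ) + 1)
    · obtain ⟨V, hV⟩ := h
      refine ⟨{V}, Set.countable_singleton V, ?_, fun _ => Set.singleton_nonempty V⟩
      rintro V' rfl
      exact hV
    · exact ⟨∅, Set.countable_empty, by simp, fun h' => absurd h' h⟩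
  choose D hDc hD hDne using hex
  refine ⟨⋃ d ∈ Q, ⋃ k, D d k, ?_, ?_, ?_⟩
  · exact hQc.biUnion fun d _ => Set.countable_iUnion fun k => hDc d k
  · intro V hV
    simp only [Set.mem_iUnion] at hV
    obtain ⟨d, hd, k, hV⟩ := hV
    exact ⟨(hD d k V hV).1, (hD d k V hV).2.1⟩
  · intro p' hp' f ε hε
    obtain ⟨k, hk⟩ := exists_nat_one_div_lt (show 0 < ε / (4 * (‖f‖ + 1)) by positivity)
    set κ : ℝ := 1 / ((k : ℝ) + 1) with hκ
    have hκ0 : 0 < κ := by positivity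
    obtain ⟨V, hV, σ, hσF, hσV, hσW, hVs⟩ := hsmall _ (Nice.half f (RCLike.re (f p') - ε / 2))
      ⟨p', hp', by simp only [Set.mem_ofPred_eq]; linarith⟩ (κ / 2) (by positivity)
    obtain ⟨d, hdQ, hd⟩ := Metric.dense_iff.1 hQd σ (κ / 2) (by positivity) |>.imp
      (fun d h => And.intro h.2 h.1)
    rw [Metric.mem_ball, dist_comm, dist_eq_norm] at hd
    obtain ⟨V', hV'⟩ := hDne d k ⟨V, hV, ⟨σ, hσF, hσV⟩, fun x hx hxV => by
      have h1 := hVs x hx hxV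
      have h2 := norm_add_le (x - σ) (σ - d)
      rw [sub_add_sub_cancel] at h2
      linarith⟩
    refine ⟨V', ?_, fun x hx hxV => ?_⟩
    · simp only [Set.mem_iUnion]
      exact ⟨d, hdQ, k, hV'⟩
    · have h1 := (hD d k V' hV').2.2 x hx hxV
      have h2 := norm_sub_le (x - d) (σ - d)
      rw [sub_sub_sub_cancel_right] at h2
      have h3 : ‖x - σ‖ ≤ 2 * κ := by linarith
      have h4 := (RCLike.abs_re_le_norm (f (x - σ))).trans (f.le_opNorm _)
      have h5 : ‖f‖ * ‖x - σ‖ ≤ ε / 2 := by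
        calc _ ≤ (‖f‖ + 1) * (2 * κ) := mul_le_mul (by linarith) h3 (norm_nonneg _) (by positivity)
          _ ≤ (‖f‖ + 1) * (2 * (ε / (4 * (‖f‖ + 1)))) := by gcongr
          _ = ε / 2 := by field_simp; ring
      have h6 := (abs_le.1 (h4.trans h5)).1
      rw [map_sub, map_sub] at h6
      simp only [Set.mem_ofPred_eq] at hσW
      linarith

open Classical in
/-- If a set of points `B` norms all functionals of `span F` as well as `s`, then
`conv B` meets each weak neighbourhood of `s` defined by `F`. -/
theorem conv_meets (B : Set X) (s : X) (F : Finset (X →L[𝕜] 𝕜)) (r : ℝ) (hr : 0 < r)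
    (hB : ∀ g ∈ Submodule.span 𝕜 (F : Set (X →L[𝕜] 𝕜)), ∀ ε > 0, ∃ b ∈ B,
      RCLike.re (g s) - ε < RCLike.re (g b)) :
    ∃ z ∈ convexHull ℝ B, ∀ f ∈ F, ‖f (z - s)‖ < r := by
  let Φ : X →L[𝕜] (F → 𝕜) := ContinuousLinearMap.pi fun f => f.1
  let Φr : X →ₗ[ℝ] (F → 𝕜) :=
    { toFun := Φ
      map_add' := fun x y => map_add Φ x y
      map_smul' := fun a x => by
        ext f
        simp only [Φ, ContinuousLinearMap.coe_pi', RingHom.id_apply, Pi.smul_apply]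
        rw [re_smul_real, RCLike.real_smul_eq_coe_mul] }
  have hconv : Convex ℝ (Φ '' convexHull ℝ B) := (convex_convexHull ℝ B).linear_image Φr
  have hmem : Φ s ∈ closure (Φ '' convexHull ℝ B) := by
    by_contra hns
    obtain ⟨l, u, hl1, hl2⟩ := RCLike.geometric_hahn_banach_closed_point (𝕜 := 𝕜)
      hconv.closure isClosed_closure hns
    have hspan : l.comp Φ ∈ Submodule.span 𝕜 (F : Set (X →L[𝕜] 𝕜)) := by
      have : l.comp Φ = ∑ f : F, l (Pi.single f 1) • f.1 := by
        ext x
        have hx : Φ x = ∑ f : F, (f.1 x) • (Pi.single f (1 : 𝕜) : F → 𝕜) := by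
          ext f
          simp [Φ, Finset.sum_apply, Pi.single_apply]
        rw [ContinuousLinearMap.comp_apply, hx, map_sum]
        simp [mul_comm]
      rw [this]
      exact Submodule.sum_mem _ fun f _ => Submodule.smul_mem _ _ (Submodule.subset_span f.2)
    obtain ⟨b, hb, hb'⟩ := hB _ hspan (RCLike.re (l (Φ s)) - u) (by linarith)
    have := hl1 (Φ b) (subset_closure ⟨b, subset_convexHull ℝ B hb, rfl⟩)
    simp only [ContinuousLinearMap.comp_apply] at hb'
    linarith
  obtain ⟨_, ⟨z, hz, rfl⟩, hd⟩ := Metric.mem_closure_iff.1 hmem r hr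
  refine ⟨z, hz, fun f hf => ?_⟩
  have h1 := dist_le_pi_dist (Φ s) (Φ z) ⟨f, hf⟩
  have h2 := h1.trans_lt hd
  rw [dist_comm, dist_eq_norm] at h2
  rw [map_sub]
  exact h2

set_option maxHeartbeats 1000000 in
theorem isSCD_of_wcd (A : Set X) (hAc : Convex ℝ A) (hA : IsBounded A)
    (h : ∀ η > 0, WCD 𝕜 (Metric.thickening η A)) : IsSCD 𝕜 A := by
  have h' : ∀ k : ℕ, WCD 𝕜 (Metric.thickening (1 / ((k : ℝ) + 1)) A) := fun k =>
    h _ (by positivity)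
  choose C hCc hCn hCd using h'
  have hex : ∀ (k : ℕ) (V : Set X), ∃ F : Finset (X →L[𝕜] 𝕜), V ∈ C k →
      ∃ s ∈ Metric.thickening (1 / ((k : ℝ) + 1)) A, ∃ r > 0,
        ∀ x, (∀ f ∈ F, ‖f (x - s)‖ < r) → x ∈ V := by
    intro k V
    by_cases hV : V ∈ C k
    · obtain ⟨hn, s, hs, hsV⟩ := hCn k V hV
      obtain ⟨F, r, hr, hF⟩ := hn.weak s hsV
      exact ⟨F, fun _ => ⟨s, hs, r, hr, hF⟩⟩
    · exact ⟨∅, fun h => absurd h hV⟩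
  choose F hF using hex
  let FF : Set (X →L[𝕜] 𝕜) := ⋃ k, ⋃ V ∈ C k, (F k V : Set (X →L[𝕜] 𝕜))
  have hFFc : FF.Countable := Set.countable_iUnion fun k =>
    (hCc k).biUnion fun V _ => (F k V).countable_toSet
  have hsep : TopologicalSpace.IsSeparable
      ((Submodule.span 𝕜 FF : Submodule 𝕜 (X →L[𝕜] 𝕜)) : Set (X →L[𝕜] 𝕜)) :=
    hFFc.isSeparable.span
  obtain ⟨Q, hQM, hQc, hQd⟩ := hsep.exists_countable_dense_subset
  let SS : Set (Set X) := insert (Slice 𝕜 A 0 1)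
    ((fun t : (X →L[𝕜] 𝕜) × ℕ => Slice 𝕜 A t.1 (1 / ((t.2 : ℝ) + 1))) '' (Q ×ˢ Set.univ))
  have hSSc : SS.Countable := ((hQc.prod Set.countable_univ).image _).insert _
  obtain ⟨S, hS⟩ := hSSc.exists_eq_range (Set.insert_nonempty _ _)
  refine ⟨S, fun n => ?_, ?_⟩
  · have : S n ∈ SS := hS ▸ Set.mem_range_self n
    rcases this with h0 | ⟨t, -, ht⟩
    · exact ⟨0, 1, one_pos, h0⟩
    · exact ⟨t.1, _, by positivity, ht.symm⟩
  intro B hBA hBm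
  obtain ⟨K, hK⟩ := hA.exists_norm_le
  -- `B` norms the span
  have hnorm : ∀ g ∈ Submodule.span 𝕜 FF, ∀ a ∈ A, ∀ ε > 0, ∃ b ∈ B,
      RCLike.re (g a) - ε < RCLike.re (g b) := by
    intro g hg a ha ε hε
    obtain ⟨g', hg'Q, hg'⟩ := Metric.mem_closure_iff.1 (hQd hg) (ε / (4 * (|K| + 1))) (by positivity)
    rw [dist_eq_norm] at hg'
    have hdiff : ∀ x ∈ A, |RCLike.re (g x) - RCLike.re (g' x)| ≤ ε / 4 := by
      intro x hx
      rw [← map_sub, ← sub_apply]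
      refine (RCLike.abs_re_le_norm _).trans (((g - g').le_opNorm x).trans ?_)
      calc _ ≤ ε / (4 * (|K| + 1)) * (|K| + 1) :=
            mul_le_mul hg'.le ((hK x hx).trans (by linarith [le_abs_self K])) (norm_nonneg _)
              (by positivity)
        _ = ε / 4 := by field_simp
    obtain ⟨k, hk⟩ := exists_nat_one_div_lt (show 0 < ε / 4 by positivity)
    have : Slice 𝕜 A g' (1 / ((k : ℝ) + 1)) ∈ SS :=
      Set.mem_insert_of_mem _ ⟨(g', k), ⟨hg'Q, trivial⟩, rfl⟩
    rw [hS] at this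
    obtain ⟨n, hn⟩ := this
    obtain ⟨b, hbB, hbS⟩ := hBm n
    rw [hn] at hbS
    refine ⟨b, hbB, ?_⟩
    have hbdd : BddAbove ((fun a => RCLike.re (g' a)) '' A) := by
      refine ⟨‖g'‖ * K, ?_⟩
      rintro _ ⟨x, hx, rfl⟩
      exact (RCLike.re_le_norm _).trans ((g'.le_opNorm x).trans
        (mul_le_mul_of_nonneg_left (hK x hx) (norm_nonneg _)))
    have h1 : RCLike.re (g' a) ≤ sSup ((fun a => RCLike.re (g' a)) '' A) :=
      le_csSup hbdd ⟨a, ha, rfl⟩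
    have h2 := hbS.2
    have h3 := (abs_le.1 (hdiff a ha)).2
    have h4 := (abs_le.1 (hdiff b (hBA hbB))).1
    linarith
  intro a ha
  by_contra hna
  obtain ⟨f, u, hf1, hf2⟩ := RCLike.geometric_hahn_banach_closed_point (𝕜 := 𝕜)
    (convex_convexHull ℝ B).closure isClosed_closure hna
  set ε := RCLike.re (f a) - u with hε
  have hε0 : 0 < ε := by linarith
  obtain ⟨k, hk⟩ := exists_nat_one_div_lt (show 0 < ε / (2 * (‖f‖ + 1)) by positivity)
  have hη0 : 0 < 1 / ((k : ℝ) + 1) := by positivity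
  have hFk := hF k
  have hCdk := hCd k
  generalize 1 / ((k : ℝ) + 1) = η at hk hη0 hFk hCdk
  obtain ⟨V, hV, hVf⟩ := hCdk a (Metric.self_subset_thickening hη0 A ha) f (ε / 2) (by positivity)
  obtain ⟨s, hs, r, hr, hsV⟩ := hFk V hV
  obtain ⟨a0, ha0, hsa0⟩ := Metric.mem_thickening_iff.1 hs
  obtain ⟨z, hz, hzF⟩ := conv_meets (Metric.thickening η B) s (F k V) r hr (by
    intro g hg δ hδ
    have hg' : g ∈ Submodule.span 𝕜 FF := Submodule.span_mono
      (fun f hf => Set.mem_iUnion.2 ⟨k, Set.mem_biUnion hV hf⟩) hg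
    obtain ⟨b, hb, hb'⟩ := hnorm g hg' a0 ha0 δ hδ
    refine ⟨b + (s - a0), Metric.mem_thickening_iff.2 ⟨b, hb, ?_⟩, ?_⟩
    · rw [dist_eq_norm] at hsa0 ⊢
      simpa using hsa0
    · simp only [map_add, map_sub]
      linarith)
  have hzV := hsV z hzF
  have hzA : z ∈ Metric.thickening η A :=
    convexHull_min (Metric.thickening_subset_of_subset η hBA) (hAc.thickening η) hz
  have h1 := hVf z hzA hzV
  have h2 : Metric.thickening η B ⊆ {x : X | RCLike.re (f (x - a)) < -(ε / 2)} := by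
    intro x hx
    obtain ⟨b, hb, hxb⟩ := Metric.mem_thickening_iff.1 hx
    rw [dist_eq_norm] at hxb
    have h3 := hf1 b (subset_closure (subset_convexHull ℝ B hb))
    have h4 := (RCLike.re_le_norm (f (x - b))).trans (f.le_opNorm _)
    have h5 : ‖f‖ * ‖x - b‖ ≤ ε / 2 := by
      calc _ ≤ (‖f‖ + 1) * (ε / (2 * (‖f‖ + 1))) :=
            mul_le_mul (by linarith) (by linarith) (norm_nonneg _) (by positivity)
        _ = ε / 2 := by field_simp
    simp only [map_sub, Set.mem_ofPred_eq] at h4 ⊢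
    linarith
  have h6 := convexHull_min h2 (Nice.low f a (ε / 2)).conv hz
  simp only [map_sub, Set.mem_ofPred_eq] at h6
  linarith

end Weak

theorem scd_all {𝕜 : Type*} [RCLike 𝕜] {X : Type*} [NormedAddCommGroup X]
    [NormedSpace ℝ X] [NormedSpace 𝕜 X] [IsScalarTower ℝ 𝕜 X] [CompleteSpace X]
    [TopologicalSpace.SeparableSpace X] (Y : Submodule 𝕜 X) (hno : ¬ HasL1 Y)
    (hY : ∀ A : Set X, IsBounded A → ∀ p ∈ A, WCD 𝕜 {x | x ∈ A ∧ x - p ∈ Y})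
    (A : Set X) (hAc : Convex ℝ A) (hA : IsBounded A) : IsSCD 𝕜 A :=
  isSCD_of_wcd A hAc hA fun η _ => wcd_open Y hno _ hA.thickening (hAc.thickening η)
    Metric.isOpen_thickening (hY _ hA.thickening)

end SCDProof

/-- Let `X` be a separable Banach space which is not an SCD space. Then
`X` contains a copy of `ℓ₁`, and for every closed subspace `Y` of `X` isomorphic to `ℓ₁`
the quotient `X/Y` also contains a copy of `ℓ₁`. -/
theorem statement11 {𝕜 : Type*} [RCLike 𝕜] {X : Type*} [NormedAddCommGroup X]
    [NormedSpace ℝ X] [NormedSpace 𝕜 X] [IsScalarTower ℝ 𝕜 X] [CompleteSpace X]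
    [TopologicalSpace.SeparableSpace X]
    (hnotSCD : ¬ ∀ A : Set X, Convex ℝ A → IsBounded A → IsSCD 𝕜 A) :
    ContainsCopyOfL1 𝕜 X ∧
      ∀ Y : Submodule 𝕜 X, IsClosed (Y : Set X) →
        Nonempty (lp (fun _ : ℕ => 𝕜) 1 ≃L[𝕜] Y) →
        ContainsCopyOfL1 𝕜 (X ⧸ Y) := by
  constructor
  · by_contra hno
    apply hnotSCD
    refine SCDProof.scd_all (⊥ : Submodule 𝕜 X) ?_ ?_
    · rintro ⟨T, c, hc, h⟩
      exact hno ⟨T, c, hc, fun v => by simpa using h v 0 (Submodule.zero_mem _)⟩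
    · intro A _ p hp
      refine ⟨{Set.univ}, Set.countable_singleton _, ?_, ?_⟩
      · rintro V rfl
        exact ⟨SCDProof.Nice.univ, p, ⟨hp, by simp⟩, trivial⟩
      · rintro p' ⟨-, hp'⟩ f ε hε
        refine ⟨Set.univ, rfl, ?_⟩
        rintro x ⟨-, hx⟩ -
        rw [Submodule.mem_bot, sub_eq_zero] at hp' hx
        subst hp' hx
        linarith
  · rintro Y - ⟨e⟩
    by_contra hno
    apply hnotSCD
    refine SCDProof.scd_all Y ?_ fun A hA p _ => SCDProof.wcd_fibre Y e A hA p
    rintro ⟨T, c, hc, h⟩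
    apply hno
    let q : X →L[𝕜] X ⧸ Y := Y.mkQL
    refine ⟨q.comp T, c, hc, fun v => ?_⟩
    refine le_of_forall_pos_le_add fun ε hε => ?_
    obtain ⟨m, hm1, hm2⟩ := Submodule.Quotient.norm_mk_lt ((q.comp T) v) hε
    have hy : T v - m ∈ Y := by
      rw [← Submodule.Quotient.eq]
      exact hm1.symm
    have := h v _ hy
    rw [sub_sub_cancel] at this
    linarith
end

section
/- Let X be a real or complex Banach space and let A be a bounded convex subset of X. Then A is an SCD set if and only if there is a sequence {V_n : n ∈ ℕ} of convex combinations of slices of A such that every nonempty relatively weakly open subset of A contains some V_n. -/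
open Bornology Metric Topology

/-- The weak topology `σ(X, X*)` on `X`: the coarsest topology making every continuous
linear functional continuous. -/
def weakTopology (𝕜 : Type*) [RCLike 𝕜] (X : Type*) [SeminormedAddCommGroup X]
    [NormedSpace 𝕜 X] : TopologicalSpace X :=
  ⨅ f : X →L[𝕜] 𝕜, TopologicalSpace.induced f inferInstance

/-- `U ⊆ X` is open for the weak topology `σ(X, X*)`. -/
def WeaklyOpen (𝕜 : Type*) [RCLike 𝕜] {X : Type*} [SeminormedAddCommGroup X]
    [NormedSpace 𝕜 X] (U : Set X) : Prop :=
  IsOpen[weakTopology 𝕜 X] U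

/-- The subset `A`, with the topology induced by the weak topology `σ(X, X*)`, has a
countable π-base: a countable family of nonempty relatively weakly open subsets of `A`
such that every nonempty relatively weakly open subset of `A` contains one of them. -/
def HasCountableWeakPiBase (𝕜 : Type*) [RCLike 𝕜] {X : Type*} [SeminormedAddCommGroup X]
    [NormedSpace 𝕜 X] (A : Set X) : Prop :=
  ∃ V : ℕ → Set X,
    (∀ n, (V n).Nonempty ∧ ∃ U : Set X, WeaklyOpen 𝕜 U ∧ V n = A ∩ U) ∧
    ∀ U : Set X, WeaklyOpen 𝕜 U → (A ∩ U).Nonempty → ∃ n, V n ⊆ A ∩ U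

open Pointwise in
/-- `W` is a convex combination of slices of `A`: `W = λ₁ S₁ + ⋯ + λₘ Sₘ` (Minkowski sum)
where the `Sᵢ` are slices of `A` and the `λᵢ` are positive reals summing to `1`. -/
def IsConvexCombOfSlices (𝕜 : Type*) [RCLike 𝕜] {X : Type*} [SeminormedAddCommGroup X]
    [NormedSpace ℝ X] [NormedSpace 𝕜 X] (A W : Set X) : Prop :=
  ∃ (m : ℕ) (lam : Fin m → ℝ) (S : Fin m → Set X),
    (∀ i, 0 < lam i) ∧ (∑ i, lam i) = 1 ∧ (∀ i, IsSlice 𝕜 A (S i)) ∧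
    W = ∑ i, lam i • S i

section Helpers

variable {𝕜 : Type*} [RCLike 𝕜] {X : Type*} [NormedAddCommGroup X] [NormedSpace 𝕜 X]

lemma slice_bddAbove {A : Set X} (hbdd : IsBounded A) (f : X →L[𝕜] 𝕜) :
    BddAbove ((fun a => RCLike.re (f a)) '' A) := by
  obtain ⟨C, hC⟩ := hbdd.exists_norm_le
  refine ⟨‖f‖ * C, ?_⟩
  rintro _ ⟨a, ha, rfl⟩
  calc RCLike.re (f a) ≤ ‖f a‖ := RCLike.re_le_norm _
    _ ≤ ‖f‖ * ‖a‖ := f.le_opNorm a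
    _ ≤ ‖f‖ * C := by gcongr; exact hC a ha

lemma exists_near_sup {A : Set X} (hne : A.Nonempty) (φ : X → ℝ) {ε : ℝ} (hε : 0 < ε) :
    ∃ y ∈ A, sSup (φ '' A) - ε < φ y := by
  obtain ⟨_, ⟨y, hy, rfl⟩, h⟩ := exists_lt_of_lt_csSup (hne.image φ)
    (show sSup (φ '' A) - ε < sSup (φ '' A) by linarith)
  exact ⟨y, hy, h⟩

lemma isSlice_nonempty {A S : Set X} (hne : A.Nonempty) (hS : IsSlice 𝕜 A S) : S.Nonempty := by
  obtain ⟨f, ε, hε, rfl⟩ := hS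
  obtain ⟨y, hy, h⟩ := exists_near_sup hne (fun a => RCLike.re (f a)) hε
  exact ⟨y, hy, h⟩

/-- Every slice contains a slice on which a given operator into a Hilbert space has
small oscillation. -/
lemma small_slice {E : Type*} [NormedAddCommGroup E] [InnerProductSpace 𝕜 E]
    {A : Set X} (hbdd : IsBounded A) (hne : A.Nonempty) (T : X →L[𝕜] E)
    (f : X →L[𝕜] 𝕜) {ε ρ : ℝ} (hε : 0 < ε) (hρ : 0 < ρ) :
    ∃ (g : X →L[𝕜] 𝕜) (η : ℝ), 0 < η ∧ Slice 𝕜 A g η ⊆ Slice 𝕜 A f ε ∧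
      ∀ x ∈ Slice 𝕜 A g η, ∀ y ∈ Slice 𝕜 A g η, ‖T x - T y‖ < ρ := by
  obtain ⟨C, hC0, hC⟩ := hbdd.exists_pos_norm_le
  set M : ℝ := ‖T‖ * C with hM
  have hM0 : 0 ≤ M := by positivity
  have hTM : ∀ x ∈ A, ‖T x‖ ≤ M := fun x hx =>
    (T.le_opNorm x).trans (mul_le_mul_of_nonneg_left (hC x hx) (norm_nonneg T))
  set η : ℝ := ρ ^ 2 / 16 with hη
  have hη0 : 0 < η := by positivity
  set t : ℝ := 4 * (M ^ 2 + η) / ε with ht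
  have ht0 : 0 < t := by positivity
  have htε : t * ε = 4 * (M ^ 2 + η) := by rw [ht]; field_simp
  set φ : X → ℝ := fun x => ‖T x‖ ^ 2 + 2 * t * RCLike.re (f x) with hφ
  have hfb := slice_bddAbove hbdd f
  have hφb : BddAbove (φ '' A) := by
    obtain ⟨K, hK⟩ := hfb
    refine ⟨M ^ 2 + 2 * t * K, ?_⟩
    rintro _ ⟨a, ha, rfl⟩
    have h1 := hTM a ha
    have h2 : RCLike.re (f a) ≤ K := hK ⟨a, ha, rfl⟩
    simp only [hφ]
    gcongr
  obtain ⟨y, hyA, hy⟩ := exists_near_sup hne φ hη0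
  obtain ⟨z, hzA, hz⟩ := exists_near_sup hne (fun a => RCLike.re (f a)) (half_pos hε)
  have hφle : ∀ x ∈ A, φ x < φ y + η := fun x hx => by
    have := le_csSup hφb ⟨x, hx, rfl⟩
    linarith
  set g : X →L[𝕜] 𝕜 := (innerSL 𝕜 (T y)).comp T + (t : 𝕜) • f with hg
  have hgx : ∀ x, RCLike.re (g x) = RCLike.re (inner 𝕜 (T y) (T x)) + t * RCLike.re (f x) := by
    intro x
    simp [hg]
  have hgy : RCLike.re (g y) = ‖T y‖ ^ 2 + t * RCLike.re (f y) := by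
    rw [hgx, inner_self_eq_norm_sq]
  have hslice : ∀ x ∈ Slice 𝕜 A g η, x ∈ A ∧ RCLike.re (g y) - η < RCLike.re (g x) := by
    rintro x ⟨hx, h⟩
    have := le_csSup (slice_bddAbove hbdd g) ⟨y, hyA, rfl⟩
    exact ⟨hx, by linarith⟩
  have hclose : ∀ x ∈ Slice 𝕜 A g η, ‖T y - T x‖ < ρ / 2 := by
    intro x hx
    obtain ⟨hxA, h⟩ := hslice x hx
    have h1 := norm_sub_sq (𝕜 := 𝕜) (T y) (T x)
    have h2 := hφle x hxA
    simp only [hφ] at h2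
    have h3 := hgx x
    refine lt_of_pow_lt_pow_left₀ 2 (by positivity) ?_
    nlinarith
  refine ⟨g, η, hη0, ?_, ?_⟩
  · intro x hx
    obtain ⟨hxA, h⟩ := hslice x hx
    refine ⟨hxA, ?_⟩
    have h1 : RCLike.re (inner 𝕜 (T y) (T x)) ≤ M * M :=
      (re_inner_le_norm _ _).trans (by gcongr; exacts [hTM y hyA, hTM x hxA])
    have h2 := hφle z hzA
    simp only [hφ] at h2
    have h3 := hgx x
    have h4 : ‖T y‖ ^ 2 ≤ M ^ 2 := by gcongr; exact hTM y hyA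
    have h5 := mul_lt_mul_of_pos_left hz ht0
    refine lt_of_mul_lt_mul_left ?_ ht0.le
    have h6 := sq_nonneg ‖T z‖
    have h7 := sq_nonneg ‖T y‖
    rw [mul_sub] at h5 ⊢
    nlinarith
  · intro x hx x' hx'
    calc ‖T x - T x'‖ = ‖(T y - T x') - (T y - T x)‖ := by congr 1; abel
      _ ≤ ‖T y - T x'‖ + ‖T y - T x‖ := norm_sub_le _ _
      _ < ρ := by linarith [hclose x hx, hclose x' hx']

lemma weaklyOpen_halfspace (f : X →L[𝕜] 𝕜) (u : ℝ) :
    WeaklyOpen 𝕜 {x : X | u < RCLike.re (f x)} := by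
  have h : IsOpen[TopologicalSpace.induced f inferInstance] {x : X | u < RCLike.re (f x)} :=
    ⟨{c : 𝕜 | u < RCLike.re c}, isOpen_lt continuous_const RCLike.continuous_re, rfl⟩
  exact (iInf_le (fun f : X →L[𝕜] 𝕜 => TopologicalSpace.induced f inferInstance) f) _ h

lemma weaklyOpen_basis {U : Set X} (hU : WeaklyOpen 𝕜 U) {a : X} (ha : a ∈ U) :
    ∃ (F : Finset (X →L[𝕜] 𝕜)) (ε : ℝ), 0 < ε ∧
      ∀ x, (∀ f ∈ F, ‖f x - f a‖ < ε) → x ∈ U := by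
  classical
  have h : U ∈ @nhds X (weakTopology 𝕜 X) a := @IsOpen.mem_nhds X (weakTopology 𝕜 X) a U hU ha
  rw [weakTopology, nhds_iInf, Filter.mem_iInf'] at h
  obtain ⟨I, hI, V, hV, -, hUV, -⟩ := h
  have hV' : ∀ f : X →L[𝕜] 𝕜, ∃ ε > 0, ∀ x, ‖f x - f a‖ < ε → x ∈ V f := by
    intro f
    have := hV f
    rw [nhds_induced, Filter.mem_comap] at this
    obtain ⟨W, hW, hWV⟩ := this
    obtain ⟨ε, hε, hb⟩ := Metric.mem_nhds_iff.1 hW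
    exact ⟨ε, hε, fun x hx => hWV (hb (by simpa [dist_eq_norm] using hx))⟩
  choose e he hev using hV'
  have : ∃ ε > 0, ∀ f ∈ hI.toFinset, ε ≤ e f := by
    induction hI.toFinset using Finset.induction_on with
    | empty => exact ⟨1, one_pos, by simp⟩
    | insert f s _ ih =>
      obtain ⟨ε, hε, h⟩ := ih
      refine ⟨min ε (e f), lt_min hε (he f), ?_⟩
      intro f' hf'
      rcases Finset.mem_insert.1 hf' with rfl | h'
      · exact min_le_right _ _
      · exact (min_le_left _ _).trans (h _ h')
  obtain ⟨ε, hε, h⟩ := this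
  refine ⟨hI.toFinset, ε, hε, fun x hx => ?_⟩
  rw [hUV]
  simp only [Set.mem_iInter]
  intro f hf
  have hf' : f ∈ hI.toFinset := by simpa using hf
  exact hev f x ((hx f hf').trans_le (h f hf'))

variable [NormedSpace ℝ X]

lemma determining_slice [IsScalarTower ℝ 𝕜 X] {A : Set X} {S : ℕ → Set X}
    (hne : A.Nonempty) (hbdd : IsBounded A) (hS : ∀ n, IsSlice 𝕜 A (S n))
    (hdet : Determining A S) (f : X →L[𝕜] 𝕜) {ε : ℝ} (hε : 0 < ε) :
    ∃ n, S n ⊆ Slice 𝕜 A f ε := by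
  by_contra! hcon
  have h1 : ∀ n, ∃ b ∈ S n, b ∉ Slice 𝕜 A f ε := fun n => Set.not_subset.1 (hcon n)
  choose b hbS hb using h1
  have hbA : ∀ n, b n ∈ A := fun n => by
    obtain ⟨g, η, -, h⟩ := hS n
    have := hbS n
    rw [h] at this
    exact this.1
  have hsub := hdet (Set.range b) (by rintro _ ⟨n, rfl⟩; exact hbA n)
    (fun n => ⟨b n, ⟨n, rfl⟩, hbS n⟩)
  obtain ⟨y, hy, hyf⟩ := exists_near_sup hne (fun a => RCLike.re (f a)) hε
  set u := sSup ((fun a => RCLike.re (f a)) '' A) - ε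
  have hconv : Convex ℝ {x : X | RCLike.re (f x) ≤ u} := by
    intro x hx y hy c d hc hd hcd
    simp only [Set.mem_setOf_eq] at *
    have e1 : ∀ (r : ℝ) (v : X), f (r • v) = r • f v := fun r v =>
      map_real_smul f f.continuous r v
    rw [map_add, map_add, e1, e1, RCLike.smul_re, RCLike.smul_re]
    have : u = c * u + d * u := by rw [← add_mul, hcd, one_mul]
    rw [this]
    gcongr
  have hclosed : IsClosed {x : X | RCLike.re (f x) ≤ u} :=
    isClosed_le (RCLike.continuous_re.comp f.continuous) continuous_const
  have : closure (convexHull ℝ (Set.range b)) ⊆ {x : X | RCLike.re (f x) ≤ u} := by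
    refine closure_minimal (convexHull_min ?_ hconv) hclosed
    rintro _ ⟨n, rfl⟩
    by_contra h
    exact hb n ⟨hbA n, not_le.1 h⟩
  exact absurd (this (hsub hy)) (not_le.2 hyf)

open Pointwise in
lemma scd_comb [IsScalarTower ℝ 𝕜 X] {E : Type*} [NormedAddCommGroup E] [InnerProductSpace 𝕜 E]
    [NormedSpace ℝ E] {A : Set X} {S : ℕ → Set X}
    (hbdd : IsBounded A) (hS : ∀ n, IsSlice 𝕜 A (S n))
    (hdet : Determining A S) (T : X →L[𝕜] E) {a : X} (ha : a ∈ A) {ρ : ℝ} (hρ : 0 < ρ) :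
    ∃ (m : ℕ) (q : Fin m → ℚ) (k : Fin m → ℕ), 0 < m ∧ (∀ i, 0 < q i) ∧
      ∀ x ∈ ∑ i, ((q i : ℝ) / ∑ j, (q j : ℝ)) • S (k i), ‖T x - T a‖ < ρ := by
  have hne : A.Nonempty := ⟨a, ha⟩
  have hSA : ∀ n, S n ⊆ A := fun n => by
    obtain ⟨g, η, -, h⟩ := hS n
    rw [h]
    exact fun x hx => hx.1
  have hSne : ∀ n, (S n).Nonempty := fun n => isSlice_nonempty hne (hS n)
  choose b hb using hSne
  let N : Set ℕ := {n | ∀ x ∈ S n, ∀ y ∈ S n, ‖T x - T y‖ < ρ / 2}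
  have hacl : a ∈ closure (convexHull ℝ (b '' N)) := by
    by_contra hcon
    obtain ⟨f, u, hu, hua⟩ := RCLike.geometric_hahn_banach_closed_point (𝕜 := 𝕜)
      (convex_convexHull ℝ (b '' N)).closure isClosed_closure hcon
    have hsup := le_csSup (slice_bddAbove hbdd f) ⟨a, ha, rfl⟩
    obtain ⟨g, η, hη, hsub, hosc⟩ := small_slice hbdd hne T f
      (ε := sSup ((fun a => RCLike.re (f a)) '' A) - u) (by linarith) (half_pos hρ)
    obtain ⟨n, hn⟩ := determining_slice hne hbdd hS hdet g hη
    have hnN : n ∈ N := fun x hx y hy => hosc x (hn hx) y (hn hy)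
    have h1 := hu _ (subset_closure (subset_convexHull ℝ _ ⟨n, hnN, rfl⟩))
    have h2 := (hsub (hn (hb n))).2
    linarith
  have hopen : IsOpen {x : X | ‖T x - T a‖ < ρ / 2} :=
    isOpen_lt ((T.continuous.sub continuous_const).norm) continuous_const
  obtain ⟨c, hc, hcc⟩ := mem_closure_iff.1 hacl _ hopen (by simpa using half_pos hρ)
  obtain ⟨ι, hι, z, w, hz, -, hw, hw1, hwz⟩ := eq_pos_convex_span_of_mem_convexHull hcc
  have hz' : ∀ i, ∃ n ∈ N, b n = z i := fun i => hz ⟨i, rfl⟩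
  choose k' hk'N hk' using hz'
  let e := Fintype.equivFin ι
  set m := Fintype.card ι
  let k : Fin m → ℕ := fun i => k' (e.symm i)
  have hm : 0 < m := by
    rcases Nat.eq_zero_or_pos m with h | h
    · have : IsEmpty ι := Fintype.card_eq_zero_iff.1 h
      simp at hw1
    · exact h
  have : NeZero m := ⟨hm.ne'⟩
  let w' : Fin m → ℝ := fun i => w (e.symm i)
  have hw'1 : ∑ i, w' i = 1 := by rw [← hw1]; exact e.symm.sum_comp w
  have hwz' : ∑ i, w' i • b (k i) = c := by
    rw [← hwz, ← e.symm.sum_comp]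
    exact Finset.sum_congr rfl fun i _ => by simp [w', k, hk']
  let P : Set (Fin m → ℝ) := {μ | ∀ i, 0 < μ i}
  have hPo : IsOpen P := by
    have : P = ⋂ i, {μ : Fin m → ℝ | 0 < μ i} := by ext; simp [P]
    rw [this]
    exact isOpen_iInter_of_finite fun i => isOpen_lt continuous_const (continuous_apply i)
  let G : (Fin m → ℝ) → X := fun μ => ∑ i, (μ i / ∑ j, μ j) • b (k i)
  have hG : ContinuousOn G P := by
    refine continuousOn_finsetSum _ fun i _ => ?_
    refine ContinuousOn.smul (ContinuousOn.div (by fun_prop) (by fun_prop) ?_) continuousOn_const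
    intro μ hμ
    exact (Finset.sum_pos (fun i _ => hμ i) Finset.univ_nonempty).ne'
  have hQo : IsOpen (P ∩ G ⁻¹' {x : X | ‖T x - T a‖ < ρ / 2}) := hG.isOpen_inter_preimage hPo hopen
  have hdense : DenseRange (Pi.map (fun (_ : Fin m) (r : ℚ) => (r : ℝ))) :=
    DenseRange.piMap fun _ => Rat.denseRange_cast
  obtain ⟨q, hqP, hqG⟩ := hdense.exists_mem_open hQo ⟨w', fun i => hw _, by
    simp only [Set.mem_preimage, G, hw'1, div_one, hwz']
    exact hc⟩
  simp only [Set.mem_preimage, Set.mem_setOf_eq, G, Pi.map_apply] at hqG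
  have hq0 : ∀ i, 0 < (q i : ℝ) := fun i => hqP i
  have hsum : 0 < ∑ j, (q j : ℝ) := Finset.sum_pos (fun i _ => hq0 i) Finset.univ_nonempty
  refine ⟨m, q, k, hm, fun i => by exact_mod_cast hq0 i, ?_⟩
  intro x hx
  obtain ⟨v, hv, rfl⟩ := (Set.mem_fintype_sum _ _).1 hx
  have hv' : ∀ i, ∃ s ∈ S (k i), ((q i : ℝ) / ∑ j, (q j : ℝ)) • s = v i := fun i => hv i
  choose s hsS hs using hv'
  have e1 : ∀ (r : ℝ) (v : X), T (r • v) = r • T v := fun r v =>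
    map_real_smul T T.continuous r v
  have h1 : ‖T (∑ i, v i) - T (∑ i, ((q i : ℝ) / ∑ j, (q j : ℝ)) • b (k i))‖ ≤ ρ / 2 := by
    rw [map_sum, map_sum, ← Finset.sum_sub_distrib]
    calc _ ≤ ∑ i, ((q i : ℝ) / ∑ j, (q j : ℝ)) * (ρ / 2) := by
          refine norm_sum_le_of_le _ fun i _ => ?_
          rw [← hs i, e1, e1, ← smul_sub, norm_smul, Real.norm_eq_abs,
            abs_of_pos (div_pos (hq0 i) hsum)]
          have := hq0 i
          gcongr
          exact (hk'N (e.symm i) _ (hsS i) _ (hb _)).le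
      _ = ρ / 2 := by
          rw [← Finset.sum_mul, ← Finset.sum_div, div_self hsum.ne', one_mul]
  have h2 := norm_sub_le_norm_sub_add_norm_sub (T (∑ i, v i))
    (T (∑ i, ((q i : ℝ) / ∑ j, (q j : ℝ)) • b (k i))) (T a)
  linarith

end Helpers

/-- A bounded convex subset `A` of a Banach space is an SCD set if and
only if there is a sequence of convex combinations of slices of `A` such that every
nonempty relatively weakly open subset of `A` contains one of them. -/
theorem statement12 {𝕜 : Type*} [RCLike 𝕜] {X : Type*} [NormedAddCommGroup X]
    [NormedSpace ℝ X] [NormedSpace 𝕜 X] [IsScalarTower ℝ 𝕜 X] [CompleteSpace X]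
    (A : Set X) (hconv : Convex ℝ A) (hbdd : IsBounded A) :
    IsSCD 𝕜 A ↔
      ∃ V : ℕ → Set X, (∀ n, IsConvexCombOfSlices 𝕜 A (V n)) ∧
        ∀ U : Set X, WeaklyOpen 𝕜 U → (A ∩ U).Nonempty → ∃ n, V n ⊆ A ∩ U := by
  open Pointwise in
  constructor
  · rintro ⟨S, hS, hdet⟩
    have hSA : ∀ n, S n ⊆ A := fun n => by
      obtain ⟨g, η, -, h⟩ := hS n
      rw [h]
      exact fun x hx => hx.1
    let I := {p : Σ m : ℕ, (Fin m → ℚ) × (Fin m → ℕ) // 0 < p.1 ∧ ∀ i, 0 < p.2.1 i}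
    have hI : Nonempty I := ⟨⟨⟨1, fun _ => 1, fun _ => 0⟩, by simp⟩⟩
    obtain ⟨enum, henum⟩ := exists_surjective_nat I
    let W : I → Set X := fun p =>
      ∑ i, ((p.1.2.1 i : ℝ) / ∑ j, (p.1.2.1 j : ℝ)) • S (p.1.2.2 i)
    have hW0 : ∀ p : I, ∀ i, 0 < (p.1.2.1 i : ℝ) / ∑ j, (p.1.2.1 j : ℝ) := by
      intro p i
      have h := p.2.2
      have h' : ∀ j, 0 < (p.1.2.1 j : ℝ) := fun j => by exact_mod_cast h j
      exact div_pos (h' i) (Finset.sum_pos (fun j _ => h' j) ⟨i, Finset.mem_univ _⟩)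
    have hW1 : ∀ p : I, ∑ i, (p.1.2.1 i : ℝ) / ∑ j, (p.1.2.1 j : ℝ) = 1 := by
      intro p
      have h := p.2.2
      have h' : ∀ j, 0 < (p.1.2.1 j : ℝ) := fun j => by exact_mod_cast h j
      rw [← Finset.sum_div]
      exact div_self (Finset.sum_pos (fun j _ => h' j) ⟨⟨0, p.2.1⟩, Finset.mem_univ _⟩).ne'
    refine ⟨fun n => W (enum n), fun n => ⟨_, _, _, hW0 (enum n), hW1 (enum n),
      fun i => hS _, rfl⟩, ?_⟩
    rintro U hU ⟨a, haA, haU⟩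
    obtain ⟨F, ε, hε, hF⟩ := weaklyOpen_basis hU haU
    let T : X →L[𝕜] EuclideanSpace 𝕜 F :=
      (EuclideanSpace.equiv F 𝕜).symm.toContinuousLinearMap.comp
        (ContinuousLinearMap.pi fun f : F => f.1)
    obtain ⟨m, q, k, hm, hq, hx⟩ := scd_comb hbdd hS hdet T haA hε
    obtain ⟨n, hn⟩ := henum ⟨⟨m, q, k⟩, hm, hq⟩
    refine ⟨n, fun x hxn => ?_⟩
    constructor
    · obtain ⟨v, hv, rfl⟩ := (Set.mem_fintype_sum _ _).1 hxn
      have hv' : ∀ i, ∃ s ∈ S ((enum n).1.2.2 i),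
        (((enum n).1.2.1 i : ℝ) / ∑ j, ((enum n).1.2.1 j : ℝ)) • s = v i := fun i => hv i
      choose s hsS hs using hv'
      rw [← Finset.sum_congr rfl fun i _ => hs i]
      exact hconv.sum_mem (fun i _ => (hW0 _ i).le) (hW1 _) (fun i _ => hSA _ (hsS i))
    · simp only [hn] at hxn
      have h1 := hx x hxn
      refine hF x fun f hf => lt_of_le_of_lt ?_ h1
      exact PiLp.norm_apply_le (T x - T a) ⟨f, hf⟩
  · rintro ⟨V, hV, hU⟩
    choose m lam S hlam hlam1 hS hVS using hV
    let J := Σ n : ℕ, Fin (m n)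
    have hJ : Nonempty J := by
      rcases Nat.eq_zero_or_pos (m 0) with h | h
      · have := hlam1 0
        have h2 : IsEmpty (Fin (m 0)) := by rw [h]; infer_instance
        simp at this
      · exact ⟨⟨0, ⟨0, h⟩⟩⟩
    obtain ⟨enum, henum⟩ := exists_surjective_nat J
    refine ⟨fun n => S (enum n).1 (enum n).2, fun n => hS _ _, ?_⟩
    intro B hBA hB a ha
    by_contra hcon
    obtain ⟨f, u, hu, hua⟩ := RCLike.geometric_hahn_banach_closed_point (𝕜 := 𝕜)
      (convex_convexHull ℝ B).closure isClosed_closure hcon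
    obtain ⟨n, hn⟩ := hU _ (weaklyOpen_halfspace f u) ⟨a, ha, hua⟩
    have hB' : ∀ i : Fin (m n), ∃ b ∈ B, b ∈ S n i := by
      intro i
      obtain ⟨l, hl⟩ := henum ⟨n, i⟩
      obtain ⟨b, hb, hb'⟩ := hB l
      have hSl : S (enum l).1 (enum l).2 = S n i :=
        congrArg (fun p : J => S p.1 p.2) hl
      exact ⟨b, hb, hSl ▸ hb'⟩
    choose b hb hbS using hB'
    have hmem : ∑ i, lam n i • b i ∈ V n := by
      rw [hVS n]
      exact (Set.mem_fintype_sum _ _).2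
        ⟨fun i => lam n i • b i, fun i => Set.smul_mem_smul_set (hbS i), rfl⟩
    have h1 : u < RCLike.re (f (∑ i, lam n i • b i)) := (hn hmem).2
    have h2 := hu _ (subset_closure ((convex_convexHull ℝ B).sum_mem
      (fun i _ => (hlam n i).le) (hlam1 n) (fun i _ => subset_convexHull ℝ B (hb i))))
    linarith
end
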